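/- arXiv:1909.10735 — 4 statements merged into one kernel-verified Lean document; each statement's English description precedes it below -/
import Mathlib

section
/- For the Haezendonck–Goovaerts premium principle π_α the following three statements are equivalent: (i) π_α is continuous on the Young class Y^Φ with respect to Φ-convergence in distribution, i.e. whenever (X_n) ⊂ Y^Φ, X ∈ Y^Φ, X_n → X in distribution and E[Φ(|X_n|)] → E[Φ(|X|)], one has π_α(X_n) → π_α(X); (ii) π_α is continuous on the Orlicz heart H^Φ with respect to Φ-convergence in distribution (the same implication with Y^Φ replaced by H^Φ); (iii) Φ satisfies the Δ₂ condition. -/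
open MeasureTheory Filter Set Topology

/-- The Luxemburg norm associated with the Orlicz function `Θ`. -/
noncomputable def luxNorm {Ω : Type*} [MeasurableSpace Ω] (μ : Measure Ω)
    (Θ : ℝ → ℝ) (X : Ω → ℝ) : ℝ :=
  sInf {l : ℝ | 0 < l ∧ ∫⁻ ω, ENNReal.ofReal (Θ (|X ω| / l)) ∂μ ≤ 1}

/-- Membership in the Orlicz space `L^Θ`. -/
def MemOrlicz {Ω : Type*} [MeasurableSpace Ω] (μ : Measure Ω)
    (Θ : ℝ → ℝ) (X : Ω → ℝ) : Prop :=
  Measurable X ∧ ∃ l : ℝ, 0 < l ∧ ∫⁻ ω, ENNReal.ofReal (Θ (|X ω| / l)) ∂μ < ⊤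

/-- The Haezendonck–Goovaerts premium principle at level `α`. -/
noncomputable def piHG {Ω : Type*} [MeasurableSpace Ω] (μ : Measure Ω)
    (Φ : ℝ → ℝ) (α : ℝ) (X : Ω → ℝ) : ℝ :=
  ⨅ m : ℝ, (m + luxNorm μ (fun x => Φ x / (1 - α)) (fun ω => max (X ω - m) 0))

/-- Membership in the Young class `Y^Φ`. -/
def MemYoung {Ω : Type*} [MeasurableSpace Ω] (μ : Measure Ω)
    (Φ : ℝ → ℝ) (X : Ω → ℝ) : Prop :=
  Measurable X ∧ ∫⁻ ω, ENNReal.ofReal (Φ |X ω|) ∂μ < ⊤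

/-- Membership in the Orlicz heart `H^Φ`. -/
def MemHeart {Ω : Type*} [MeasurableSpace Ω] (μ : Measure Ω)
    (Φ : ℝ → ℝ) (X : Ω → ℝ) : Prop :=
  Measurable X ∧ ∀ l : ℝ, 0 < l → ∫⁻ ω, ENNReal.ofReal (Φ (|X ω| / l)) ∂μ < ⊤


lemma aux_small {Ω : Type*} [MeasurableSpace Ω] (μ : Measure Ω) [IsProbabilityMeasure μ]
    (hNA : ∀ A : Set Ω, MeasurableSet A → 0 < μ A →
      ∃ B : Set Ω, B ⊆ A ∧ MeasurableSet B ∧ 0 < μ B ∧ μ B < μ A)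
    (A : Set Ω) (hA : MeasurableSet A) (hpos : 0 < μ.real A) (ε : ℝ) (hε : 0 < ε) :
    ∃ B : Set Ω, B ⊆ A ∧ MeasurableSet B ∧ 0 < μ.real B ∧ μ.real B < ε := by
  have key : ∀ n : ℕ, ∃ B : Set Ω, B ⊆ A ∧ MeasurableSet B ∧ 0 < μ.real B ∧
      μ.real B ≤ (1 / 2 : ℝ) ^ n := by
    intro n
    induction n with
    | zero => exact ⟨A, Subset.rfl, hA, hpos, by simp⟩
    | succ n ih =>
      obtain ⟨B, hBA, hB, hB0, hBn⟩ := ih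
      have hB0' : 0 < μ B := by
        rw [measureReal_def, ENNReal.toReal_pos_iff] at hB0; exact hB0.1
      obtain ⟨C, hCB, hC, hC0, hCl⟩ := hNA B hB hB0'
      have h1 : 0 < μ.real C := by
        rw [measureReal_def]; exact ENNReal.toReal_pos hC0.ne' (measure_ne_top _ _)
      have h2 : μ.real C < μ.real B := by
        rw [measureReal_def, measureReal_def]
        exact (ENNReal.toReal_lt_toReal (measure_ne_top _ _) (measure_ne_top _ _)).2 hCl
      have h3 : μ.real (B \ C) = μ.real B - μ.real C := measureReal_sdiff hCB hC
      by_cases hh : μ.real C ≤ μ.real B / 2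
      · refine ⟨C, hCB.trans hBA, hC, h1, ?_⟩
        rw [pow_succ]; linarith
      · refine ⟨B \ C, sdiff_subset.trans hBA, hB.diff hC, by linarith, ?_⟩
        rw [pow_succ]; push Not at hh; linarith
  obtain ⟨n, hn⟩ := exists_pow_lt_of_lt_one hε (by norm_num : (1 / 2 : ℝ) < 1)
  obtain ⟨B, h1, h2, h3, h4⟩ := key n
  exact ⟨B, h1, h2, h3, h4.trans_lt hn⟩

lemma aux_sierpinski {Ω : Type*} [MeasurableSpace Ω] (μ : Measure Ω) [IsProbabilityMeasure μ]
    (hNA : ∀ A : Set Ω, MeasurableSet A → 0 < μ A →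
      ∃ B : Set Ω, B ⊆ A ∧ MeasurableSet B ∧ 0 < μ B ∧ μ B < μ A)
    (p : ℝ) (hp0 : 0 ≤ p) (hp1 : p ≤ 1) :
    ∃ B : Set Ω, MeasurableSet B ∧ μ.real B = p := by
  have step : ∀ B : {B : Set Ω // MeasurableSet B ∧ μ.real B ≤ p},
      ∃ B' : {B : Set Ω // MeasurableSet B ∧ μ.real B ≤ p}, B.1 ⊆ B'.1 ∧
        ∀ C : Set Ω, B.1 ⊆ C → MeasurableSet C → μ.real C ≤ p →
          μ.real C ≤ 2 * μ.real B'.1 - μ.real B.1 := by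
    rintro ⟨B, hB, hBp⟩
    set S : Set ℝ := {x | ∃ C : Set Ω, B ⊆ C ∧ MeasurableSet C ∧ μ.real C ≤ p ∧ x = μ.real C}
    have hbdd : BddAbove S := ⟨p, by rintro x ⟨C, _, _, h, rfl⟩; exact h⟩
    have hBS : μ.real B ∈ S := ⟨B, Subset.rfl, hB, hBp, rfl⟩
    have hBs : μ.real B ≤ sSup S := le_csSup hbdd hBS
    have : ∃ x ∈ S, (sSup S + μ.real B) / 2 ≤ x := by
      rcases hBs.eq_or_lt with h | h
      · exact ⟨_, hBS, by linarith⟩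
      · obtain ⟨x, hx, hlt⟩ := exists_lt_of_lt_csSup ⟨_, hBS⟩
          (by linarith : (sSup S + μ.real B) / 2 < sSup S)
        exact ⟨x, hx, hlt.le⟩
    obtain ⟨x, ⟨D, hBD, hD, hDp, rfl⟩, hx⟩ := this
    refine ⟨⟨D, hD, hDp⟩, hBD, ?_⟩
    intro C hBC hC hCp
    have : μ.real C ≤ sSup S := le_csSup hbdd ⟨C, hBC, hC, hCp, rfl⟩
    simp only
    linarith
  choose f hf1 hf2 using step
  let B : ℕ → {B : Set Ω // MeasurableSet B ∧ μ.real B ≤ p} := fun n =>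
    Nat.rec ⟨∅, MeasurableSet.empty, by simpa using hp0⟩ (fun _ b => f b) n
  have hBs : ∀ n, B (n + 1) = f (B n) := fun n => rfl
  have hmono : Monotone (fun n => (B n).1) :=
    monotone_nat_of_le_succ (fun n => by rw [hBs]; exact hf1 _)
  have hlim : Tendsto (fun n => μ.real (B n).1) atTop (𝓝 (μ.real (⋃ n, (B n).1))) := by
    have := tendsto_measure_iUnion_atTop (μ := μ) hmono
    exact (ENNReal.tendsto_toReal (measure_ne_top _ _)).comp this
  have hU : MeasurableSet (⋃ n, (B n).1) := MeasurableSet.iUnion (fun n => (B n).2.1)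
  have hUp : μ.real (⋃ n, (B n).1) ≤ p := le_of_tendsto' hlim (fun n => (B n).2.2)
  set U := ⋃ n, (B n).1 with hUdef
  refine ⟨U, hU, ?_⟩
  by_contra hne
  have hlt : μ.real U < p := lt_of_le_of_ne hUp hne
  have hc : 0 < μ.real Uᶜ := by
    rw [probReal_compl_eq_one_sub hU]; linarith
  obtain ⟨D, hDU, hD, hD0, hDl⟩ := aux_small μ hNA Uᶜ hU.compl hc (p - μ.real U) (by linarith)
  have hdisj : Disjoint U D := by
    rw [Set.disjoint_right]; intro x hx; exact hDU hx
  have hUD : μ.real (U ∪ D) = μ.real U + μ.real D := measureReal_union hdisj hD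
  have h1 : ∀ n, μ.real U + μ.real D ≤ 2 * μ.real (B (n + 1)).1 - μ.real (B n).1 := by
    intro n
    rw [hBs, ← hUD]
    apply hf2
    · exact (subset_iUnion (fun n => (B n).1) n).trans subset_union_left
    · exact hU.union hD
    · linarith
  have h2 : Tendsto (fun n => 2 * μ.real (B (n + 1)).1 - μ.real (B n).1) atTop
      (𝓝 (2 * μ.real U - μ.real U)) :=
    (((tendsto_add_atTop_iff_nat 1).2 hlim).const_mul 2).sub hlim
  have h3 := ge_of_tendsto' h2 h1
  linarith

structure AuxYF (Φ : ℝ → ℝ) : Prop where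
  zero : Φ 0 = 0
  one : Φ 1 = 1
  mono : MonotoneOn Φ (Ici 0)
  conv : ConvexOn ℝ (Ici 0) Φ

lemma AuxYF.nonneg {Φ : ℝ → ℝ} (h : AuxYF Φ) {x : ℝ} (hx : 0 ≤ x) : 0 ≤ Φ x := by
  have := h.mono (mem_Ici.2 le_rfl) (mem_Ici.2 hx) hx
  rwa [h.zero] at this

lemma AuxYF.le {Φ : ℝ → ℝ} (h : AuxYF Φ) {x y : ℝ} (hx : 0 ≤ x) (hxy : x ≤ y) : Φ x ≤ Φ y :=
  h.mono (mem_Ici.2 hx) (mem_Ici.2 (hx.trans hxy)) hxy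

lemma AuxYF.scale {Φ : ℝ → ℝ} (h : AuxYF Φ) {x t : ℝ} (hx : 0 ≤ x) (ht0 : 0 ≤ t) (ht1 : t ≤ 1) :
    Φ (t * x) ≤ t * Φ x := by
  have := h.conv.2 (mem_Ici.2 hx) (mem_Ici.2 le_rfl) ht0 (by linarith : 0 ≤ 1 - t) (by ring)
  simpa [h.zero] using this

lemma AuxYF.ge_self {Φ : ℝ → ℝ} (h : AuxYF Φ) {x : ℝ} (hx : 1 ≤ x) : x ≤ Φ x := by
  have := h.scale (x := x) (t := 1 / x) (by linarith) (by positivity)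
    (by rw [div_le_one (by linarith)]; exact hx)
  have hx0 : 0 < x := by linarith
  rw [one_div_mul_cancel hx0.ne', h.one, one_div, inv_mul_eq_div, le_div_iff₀ hx0] at this
  linarith

lemma AuxYF.cont {Φ : ℝ → ℝ} (h : AuxYF Φ) : Continuous (fun x : ℝ => Φ |x|) := by
  have hc : ConvexOn ℝ univ (fun x : ℝ => Φ |x|) := by
    refine ⟨convex_univ, ?_⟩
    intro x _ y _ a b ha hb hab
    have h1 : |a • x + b • y| ≤ a • |x| + b • |y| := by
      simp only [smul_eq_mul]
      refine (abs_add_le _ _).trans ?_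
      rw [abs_mul, abs_mul, abs_of_nonneg ha, abs_of_nonneg hb]
    exact (h.le (abs_nonneg _) h1).trans
      (h.conv.2 (mem_Ici.2 (abs_nonneg x)) (mem_Ici.2 (abs_nonneg y)) ha hb hab)
  exact continuousOn_univ.1 (hc.continuousOn isOpen_univ)

noncomputable def auxg (Φ : ℝ → ℝ) (α m l x : ℝ) : ℝ := Φ (|max (x - m) 0| / l) / (1 - α)

noncomputable def auxJ {Ω : Type*} [MeasurableSpace Ω] (μ : Measure Ω)
    (Φ : ℝ → ℝ) (α : ℝ) (X : Ω → ℝ) (m l : ℝ) : ENNReal :=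
  ∫⁻ ω, ENNReal.ofReal (auxg Φ α m l (X ω)) ∂μ

noncomputable def auxN {Ω : Type*} [MeasurableSpace Ω] (μ : Measure Ω)
    (Φ : ℝ → ℝ) (α : ℝ) (X : Ω → ℝ) (m : ℝ) : ℝ :=
  sInf {l : ℝ | 0 < l ∧ auxJ μ Φ α X m l ≤ 1}

lemma piHG_eq {Ω : Type*} [MeasurableSpace Ω] (μ : Measure Ω)
    (Φ : ℝ → ℝ) (α : ℝ) (X : Ω → ℝ) : piHG μ Φ α X = ⨅ m : ℝ, (m + auxN μ Φ α X m) := rfl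

lemma auxg_cont {Φ : ℝ → ℝ} (h : AuxYF Φ) (α m : ℝ) {l : ℝ} (hl : 0 < l) :
    Continuous (auxg Φ α m l) := by
  have : auxg Φ α m l = fun x => (fun y => Φ |y|) (max (x - m) 0 / l) / (1 - α) := by
    funext x
    simp only [auxg, abs_div, abs_of_pos hl]
  rw [this]
  exact (h.cont.comp (by fun_prop)).div_const _

lemma auxg_nonneg {Φ : ℝ → ℝ} (h : AuxYF Φ) {α : ℝ} (hα : α < 1) (m : ℝ) {l : ℝ} (hl : 0 < l)
    (x : ℝ) : 0 ≤ auxg Φ α m l x :=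
  div_nonneg (h.nonneg (by positivity)) (by linarith)

lemma auxg_le {Φ : ℝ → ℝ} (h : AuxYF Φ) {α : ℝ} (hα : α < 1) {m m' l l' : ℝ} (hl : 0 < l)
    (hll : l ≤ l') (hm : m ≤ m') (x : ℝ) : auxg Φ α m' l' x ≤ auxg Φ α m l x := by
  have hl' : 0 < l' := hl.trans_le hll
  unfold auxg
  refine div_le_div_of_nonneg_right (h.le (by positivity) ?_) (by linarith)
  have h1 : |max (x - m') 0| ≤ |max (x - m) 0| := by
    rw [abs_of_nonneg (le_max_right _ _), abs_of_nonneg (le_max_right _ _)]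
    exact max_le_max (by linarith) le_rfl
  exact div_le_div₀ (abs_nonneg _) h1 hl hll

lemma auxJ_le {Ω : Type*} [MeasurableSpace Ω] (μ : Measure Ω)
    {Φ : ℝ → ℝ} (h : AuxYF Φ) {α : ℝ} (hα : α < 1) (X : Ω → ℝ) {m m' l l' : ℝ} (hl : 0 < l)
    (hll : l ≤ l') (hm : m ≤ m') : auxJ μ Φ α X m' l' ≤ auxJ μ Φ α X m l :=
  lintegral_mono (fun ω => ENNReal.ofReal_le_ofReal (auxg_le h hα hl hll hm (X ω)))

lemma auxJ_scale {Ω : Type*} [MeasurableSpace Ω] (μ : Measure Ω)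
    {Φ : ℝ → ℝ} (h : AuxYF Φ) {α : ℝ} (hα : α < 1) (X : Ω → ℝ) {m l l' : ℝ}
    (hl : 0 < l) (hll : l ≤ l') :
    auxJ μ Φ α X m l' ≤ ENNReal.ofReal (l / l') * auxJ μ Φ α X m l := by
  have hl' : 0 < l' := hl.trans_le hll
  unfold auxJ
  rw [← lintegral_const_mul' _ _ ENNReal.ofReal_ne_top]
  refine lintegral_mono (fun ω => ?_)
  rw [← ENNReal.ofReal_mul (by positivity)]
  apply ENNReal.ofReal_le_ofReal
  unfold auxg
  have := h.scale (x := |max (X ω - m) 0| / l) (t := l / l') (by positivity) (by positivity)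
    (by rw [div_le_one hl']; exact hll)
  rw [show l / l' * (|max (X ω - m) 0| / l) = |max (X ω - m) 0| / l' by field_simp] at this
  rw [← mul_div_assoc]
  exact div_le_div_of_nonneg_right this (by linarith)

lemma auxN_nonneg {Ω : Type*} [MeasurableSpace Ω] (μ : Measure Ω)
    (Φ : ℝ → ℝ) (α : ℝ) (X : Ω → ℝ) (m : ℝ) : 0 ≤ auxN μ Φ α X m :=
  Real.sInf_nonneg (fun _ hl => hl.1.le)

lemma auxN_le {Ω : Type*} [MeasurableSpace Ω] (μ : Measure Ω)
    {Φ : ℝ → ℝ} {α : ℝ} {X : Ω → ℝ} {m l : ℝ} (hl : 0 < l) (hJ : auxJ μ Φ α X m l ≤ 1) :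
    auxN μ Φ α X m ≤ l :=
  csInf_le ⟨0, fun _ h => h.1.le⟩ ⟨hl, hJ⟩

lemma le_auxN {Ω : Type*} [MeasurableSpace Ω] (μ : Measure Ω)
    {Φ : ℝ → ℝ} (h : AuxYF Φ) {α : ℝ} (hα : α < 1) {X : Ω → ℝ} {m l : ℝ}
    (hne : ∃ l, 0 < l ∧ auxJ μ Φ α X m l ≤ 1) (hJ : 1 < auxJ μ Φ α X m l) :
    l ≤ auxN μ Φ α X m := by
  refine le_csInf hne ?_
  rintro b ⟨hb, hbJ⟩
  by_contra hlt
  push Not at hlt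
  exact absurd ((auxJ_le μ h hα X hb hlt.le le_rfl).trans hbJ) (not_le.2 hJ)

lemma auxN_anti {Ω : Type*} [MeasurableSpace Ω] (μ : Measure Ω)
    {Φ : ℝ → ℝ} (h : AuxYF Φ) {α : ℝ} (hα : α < 1) {X : Ω → ℝ} {m m' : ℝ}
    (hne : ∃ l, 0 < l ∧ auxJ μ Φ α X m l ≤ 1) (hm : m ≤ m') :
    auxN μ Φ α X m' ≤ auxN μ Φ α X m := by
  refine le_csInf hne ?_
  rintro b ⟨hb, hbJ⟩
  exact auxN_le μ hb ((auxJ_le μ h hα X hb le_rfl hm).trans hbJ)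

lemma young_nonempty {Ω : Type*} [MeasurableSpace Ω] (μ : Measure Ω) [IsProbabilityMeasure μ]
    {Φ : ℝ → ℝ} (h : AuxYF Φ) {α : ℝ} (hα : α < 1) {X : Ω → ℝ} (hX : MemYoung μ Φ X) (m : ℝ) :
    ∃ l, 0 < l ∧ auxJ μ Φ α X m l ≤ 1 := by
  have hfin : auxJ μ Φ α X m 2 < ⊤ := by
    have hle : auxJ μ Φ α X m 2 ≤ ∫⁻ ω, (ENNReal.ofReal (1 / (2 * (1 - α))) *
        ENNReal.ofReal (Φ |X ω|) + ENNReal.ofReal (1 / (2 * (1 - α)) * Φ |m|)) ∂μ := by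
      refine lintegral_mono (fun ω => ?_)
      have h1a : 0 < 1 - α := by linarith
      rw [← ENNReal.ofReal_mul (by positivity), ← ENNReal.ofReal_add
        (mul_nonneg (by positivity) (h.nonneg (abs_nonneg _)))
        (mul_nonneg (by positivity) (h.nonneg (abs_nonneg _)))]
      apply ENNReal.ofReal_le_ofReal
      unfold auxg
      have h1 : |max (X ω - m) 0| / 2 ≤ (1 / 2 : ℝ) • |X ω| + (1 / 2 : ℝ) • |m| := by
        rw [abs_of_nonneg (le_max_right _ _), smul_eq_mul, smul_eq_mul]
        have : max (X ω - m) 0 ≤ |X ω| + |m| :=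
          max_le (by linarith [le_abs_self (X ω), neg_abs_le m]) (by positivity)
        linarith
      have h2 := (h.le (by positivity) h1).trans (h.conv.2 (mem_Ici.2 (abs_nonneg (X ω)))
        (mem_Ici.2 (abs_nonneg m)) (by norm_num) (by norm_num) (by norm_num))
      simp only [smul_eq_mul] at h2
      calc Φ (|max (X ω - m) 0| / 2) / (1 - α) ≤ (1 / 2 * Φ |X ω| + 1 / 2 * Φ |m|) / (1 - α) :=
            div_le_div_of_nonneg_right (by simpa using h2) h1a.le
        _ = _ := by field_simp
    refine hle.trans_lt ?_
    rw [lintegral_add_right _ measurable_const, lintegral_const_mul' _ _ ENNReal.ofReal_ne_top]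
    simp only [lintegral_const, measure_univ, mul_one]
    exact ENNReal.add_lt_top.2 ⟨ENNReal.mul_lt_top ENNReal.ofReal_lt_top hX.2,
      ENNReal.ofReal_lt_top⟩
  set C := (auxJ μ Φ α X m 2).toReal with hC
  have hC0 : 0 ≤ C := ENNReal.toReal_nonneg
  have hCe : auxJ μ Φ α X m 2 = ENNReal.ofReal C := (ENNReal.ofReal_toReal hfin.ne).symm
  refine ⟨2 * (C + 1), by positivity, ?_⟩
  refine (auxJ_scale μ h hα X (by norm_num : (0:ℝ) < 2) (by linarith)).trans ?_
  rw [hCe, ← ENNReal.ofReal_mul (by positivity), ENNReal.ofReal_le_one]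
  rw [div_mul_eq_mul_div, div_le_one (by positivity)]
  linarith

/-- a constant `c > 1` giving coercivity -/
lemma exists_coer {Φ : ℝ → ℝ} (h : AuxYF Φ) {b : ℝ} (hb1 : b < 1) :
    ∃ c : ℝ, 1 < c ∧ b < Φ (1 / c) := by
  have hcont : Tendsto (fun c : ℝ => Φ |1 / c|) (𝓝[>] 1) (𝓝 1) := by
    have h1 : ContinuousAt (fun c : ℝ => Φ |1 / c|) 1 := by
      apply ContinuousAt.comp (g := fun x : ℝ => Φ |x|) h.cont.continuousAt
      fun_prop (disch := norm_num)
    have := h1.tendsto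
    simp only [div_one, abs_one, h.one] at this
    exact this.mono_left nhdsWithin_le_nhds
  obtain ⟨c, hc, hc1⟩ := ((hcont.eventually (lt_mem_nhds hb1)).and
    self_mem_nhdsWithin).exists
  refine ⟨c, hc1, ?_⟩
  have : (0:ℝ) < c := lt_trans one_pos hc1
  rwa [abs_of_pos (by positivity)] at hc

/-- lower bound of `J` through a set -/
lemma auxJ_ge {Ω : Type*} [MeasurableSpace Ω] (μ : Measure Ω) [IsProbabilityMeasure μ]
    {Φ : ℝ → ℝ} (h : AuxYF Φ) {α : ℝ} (hα : α < 1) {X : Ω → ℝ} {A : Set Ω}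
    (hA : MeasurableSet A) {m l t : ℝ} (hl : 0 < l) (ht : 0 ≤ t) (hX : ∀ ω ∈ A, t * l ≤ X ω - m)
    (hgt : 1 - α < Φ t * μ.real A) : 1 < auxJ μ Φ α X m l := by
  have h1a : 0 < 1 - α := by linarith
  have h1 : ENNReal.ofReal (Φ t / (1 - α)) * μ A ≤ auxJ μ Φ α X m l := by
    rw [← setLIntegral_const]
    refine (setLIntegral_mono' hA (fun ω hω => ?_)).trans (setLIntegral_le_lintegral A _)
    apply ENNReal.ofReal_le_ofReal
    unfold auxg
    refine div_le_div_of_nonneg_right (h.le ht ?_) h1a.le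
    rw [le_div_iff₀ hl, abs_of_nonneg (le_max_right _ _)]
    exact (hX ω hω).trans (le_max_left _ _)
  refine lt_of_lt_of_le ?_ h1
  have h2 : μ A = ENNReal.ofReal (μ.real A) := (ENNReal.ofReal_toReal (measure_ne_top _ _)).symm
  rw [h2, ← ENNReal.ofReal_mul (div_nonneg (h.nonneg ht) h1a.le), ENNReal.one_lt_ofReal,
    div_mul_eq_mul_div, lt_div_iff₀ h1a]
  linarith

lemma auxN_coer {Ω : Type*} [MeasurableSpace Ω] (μ : Measure Ω) [IsProbabilityMeasure μ]
    {Φ : ℝ → ℝ} (h : AuxYF Φ) {α : ℝ} (hα : α < 1) {X : Ω → ℝ} (hX : MemYoung μ Φ X)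
    {c q K : ℝ} (hc : 1 < c) (hq : 0 < q) (hcq : (1 - α) / q < Φ (1 / c))
    (hK : q ≤ μ.real {ω | -K ≤ X ω}) {m : ℝ} (hm : m < -K) :
    c * (-K - m) ≤ auxN μ Φ α X m := by
  have hc0 : 0 < c := by linarith
  refine le_auxN μ h hα (young_nonempty μ h hα hX m) ?_
  refine auxJ_ge μ h hα (A := {ω | -K ≤ X ω}) (measurableSet_le measurable_const hX.1)
    (mul_pos hc0 (by linarith)) (t := 1 / c) (by positivity) ?_ ?_
  · intro ω hω
    have : -K ≤ X ω := hω
    have e : 1 / c * (c * (-K - m)) = -K - m := by field_simp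
    rw [e]; linarith
  · rw [div_lt_iff₀ hq] at hcq
    exact hcq.trans_le (mul_le_mul_of_nonneg_left hK (h.nonneg (by positivity)))

lemma exists_tight {Ω : Type*} [MeasurableSpace Ω] (μ : Measure Ω) [IsProbabilityMeasure μ]
    {X : Ω → ℝ} {q : ℝ} (hq : q < 1) :
    ∃ K : ℝ, q < μ.real {ω | -K ≤ X ω} := by
  have hmono : Monotone (fun n : ℕ => {ω | -(n : ℝ) ≤ X ω}) := by
    intro a b hab ω hω
    have h1 : (a : ℝ) ≤ b := by exact_mod_cast hab
    simp only [mem_ofPred_eq] at hω ⊢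
    linarith
  have hU : ⋃ n : ℕ, {ω | -(n : ℝ) ≤ X ω} = univ := by
    ext ω
    simp only [mem_iUnion, mem_ofPred_eq, mem_univ, iff_true]
    obtain ⟨n, hn⟩ := exists_nat_ge (-X ω)
    exact ⟨n, by linarith⟩
  have := tendsto_measure_iUnion_atTop (μ := μ) hmono
  rw [hU, measure_univ] at this
  have h2 := (ENNReal.tendsto_toReal ENNReal.one_ne_top).comp this
  rw [ENNReal.toReal_one] at h2
  obtain ⟨n, hn⟩ := (h2.eventually (lt_mem_nhds hq)).exists
  exact ⟨n, hn⟩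

lemma bddBelow_young {Ω : Type*} [MeasurableSpace Ω] (μ : Measure Ω) [IsProbabilityMeasure μ]
    {Φ : ℝ → ℝ} (h : AuxYF Φ) {α : ℝ} (hα0 : 0 < α) (hα : α < 1) {X : Ω → ℝ}
    (hX : MemYoung μ Φ X) : BddBelow (range (fun m : ℝ => m + auxN μ Φ α X m)) := by
  have hq : (0:ℝ) < 1 - α / 2 := by linarith
  obtain ⟨c, hc, hcq⟩ := exists_coer h (b := (1 - α) / (1 - α / 2))
    (by rw [div_lt_one hq]; linarith)
  obtain ⟨K, hK⟩ := exists_tight μ (X := X) (q := 1 - α / 2) (by linarith)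
  refine ⟨-K, ?_⟩
  rintro _ ⟨m, rfl⟩
  simp only
  rcases lt_or_ge m (-K) with hm | hm
  · have := auxN_coer μ h hα hX hc hq hcq hK.le hm
    nlinarith
  · linarith [auxN_nonneg μ Φ α X m]

lemma aux_lsc {Ω : Type*} [MeasurableSpace Ω] (μ : Measure Ω) [IsProbabilityMeasure μ]
    {Xn : ℕ → Ω → ℝ} {X : Ω → ℝ} (hX : Measurable X) (hXn : ∀ n, Measurable (Xn n))
    (hw : ∀ f : BoundedContinuousFunction ℝ ℝ,
          Tendsto (fun n => ∫ ω, f (Xn n ω) ∂μ) atTop (𝓝 (∫ ω, f (X ω) ∂μ)))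
    {H : ℝ → ℝ} (hH : Continuous H) (hH0 : ∀ x, 0 ≤ H x)
    (hi : Integrable (fun ω => H (X ω)) μ) (hin : ∀ n, Integrable (fun ω => H (Xn n ω)) μ)
    {c : ℝ} (hc : c < ∫ ω, H (X ω) ∂μ) : ∀ᶠ n in atTop, c < ∫ ω, H (Xn n ω) ∂μ := by
  have hlim : Tendsto (fun K : ℕ => ∫ ω, min (H (X ω)) (K : ℝ) ∂μ) atTop
      (𝓝 (∫ ω, H (X ω) ∂μ)) := by
    refine tendsto_integral_of_dominated_convergence (fun ω => H (X ω)) ?_ hi ?_ ?_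
    · intro K
      exact ((hH.measurable.comp hX).min measurable_const).aestronglyMeasurable
    · intro K
      refine Eventually.of_forall (fun ω => ?_)
      rw [Real.norm_eq_abs, abs_of_nonneg (le_min (hH0 _) (Nat.cast_nonneg _))]
      exact min_le_left _ _
    · refine Eventually.of_forall (fun ω => ?_)
      obtain ⟨k, hk⟩ := exists_nat_ge (H (X ω))
      refine tendsto_const_nhds.congr' ?_
      filter_upwards [eventually_ge_atTop k] with n hn
      rw [min_eq_left]
      exact hk.trans (by exact_mod_cast hn)
  obtain ⟨K, hK⟩ := (hlim.eventually (lt_mem_nhds hc)).exists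
  let f : BoundedContinuousFunction ℝ ℝ :=
    BoundedContinuousFunction.ofNormedAddCommGroup (fun x => min (H x) (K : ℝ))
      (hH.min continuous_const) (K : ℝ) (fun x => by
        rw [Real.norm_eq_abs, abs_of_nonneg (le_min (hH0 _) (Nat.cast_nonneg _))]
        exact min_le_right _ _)
  filter_upwards [(hw f).eventually (lt_mem_nhds (show c < ∫ ω, f (X ω) ∂μ from hK))] with n hn
  refine hn.trans_le (integral_mono_of_nonneg (Eventually.of_forall (fun ω => ?_)) (hin n)
    (Eventually.of_forall (fun ω => ?_)))
  · exact le_min (hH0 _) (Nat.cast_nonneg _)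
  · exact min_le_left _ _

lemma young_integrable {Ω : Type*} [MeasurableSpace Ω] (μ : Measure Ω)
    {Φ : ℝ → ℝ} (h : AuxYF Φ) {X : Ω → ℝ} (hX : MemYoung μ Φ X) :
    Integrable (fun ω => Φ |X ω|) μ := by
  refine ⟨(h.cont.measurable.comp hX.1).aestronglyMeasurable, ?_⟩
  rw [hasFiniteIntegral_iff_ofReal (Eventually.of_forall (fun ω => h.nonneg (abs_nonneg _)))]
  exact hX.2

/-- convergence of the integrals of continuous functions dominated by `C (1 + Φ |x|)` -/
lemma aux_conv {Ω : Type*} [MeasurableSpace Ω] (μ : Measure Ω) [IsProbabilityMeasure μ]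
    {Φ : ℝ → ℝ} (h : AuxYF Φ)
    {Xn : ℕ → Ω → ℝ} {X : Ω → ℝ} (hX : MemYoung μ Φ X) (hXn : ∀ n, MemYoung μ Φ (Xn n))
    (hw : ∀ f : BoundedContinuousFunction ℝ ℝ,
          Tendsto (fun n => ∫ ω, f (Xn n ω) ∂μ) atTop (𝓝 (∫ ω, f (X ω) ∂μ)))
    (hE : Tendsto (fun n => ∫ ω, Φ |Xn n ω| ∂μ) atTop (𝓝 (∫ ω, Φ |X ω| ∂μ)))
    {H : ℝ → ℝ} (hH : Continuous H) (hH0 : ∀ x, 0 ≤ H x) {C : ℝ}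
    (hHC : ∀ x, H x ≤ C * (1 + Φ |x|)) :
    Tendsto (fun n => ∫ ω, H (Xn n ω) ∂μ) atTop (𝓝 (∫ ω, H (X ω) ∂μ)) := by
  have hint : ∀ Y : Ω → ℝ, MemYoung μ Φ Y → Integrable (fun ω => C * (1 + Φ |Y ω|)) μ :=
    fun Y hY => ((integrable_const 1).add (young_integrable μ h hY)).const_mul C
  have hintH : ∀ Y : Ω → ℝ, MemYoung μ Φ Y → Integrable (fun ω => H (Y ω)) μ := by
    intro Y hY
    refine (hint Y hY).mono' (hH.measurable.comp hY.1).aestronglyMeasurable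
      (Eventually.of_forall (fun ω => ?_))
    rw [Real.norm_eq_abs, abs_of_nonneg (hH0 _)]
    exact hHC _
  have hval : ∀ Y : Ω → ℝ, MemYoung μ Φ Y → ∫ ω, (C * (1 + Φ |Y ω|) - H (Y ω)) ∂μ =
      C * (1 + ∫ ω, Φ |Y ω| ∂μ) - ∫ ω, H (Y ω) ∂μ := by
    intro Y hY
    rw [integral_sub (hint Y hY) (hintH Y hY), integral_const_mul,
      integral_add (integrable_const 1) (young_integrable μ h hY)]
    simp
  have hCl : Tendsto (fun n => C * (1 + ∫ ω, Φ |Xn n ω| ∂μ)) atTop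
      (𝓝 (C * (1 + ∫ ω, Φ |X ω| ∂μ))) := (hE.const_add 1).const_mul C
  rw [tendsto_order]
  constructor
  · intro a ha
    exact aux_lsc μ hX.1 (fun n => (hXn n).1) hw hH hH0 (hintH X hX) (fun n => hintH _ (hXn n)) ha
  · intro a ha
    obtain ⟨b, hb1, hb2⟩ := exists_between ha
    have h1 := aux_lsc μ hX.1 (fun n => (hXn n).1) hw
      (H := fun x => C * (1 + Φ |x|) - H x)
      ((continuous_const.mul (continuous_const.add h.cont)).sub hH)
      (fun x => sub_nonneg.2 (hHC x)) ((hint X hX).sub (hintH X hX))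
      (fun n => (hint _ (hXn n)).sub (hintH _ (hXn n)))
      (c := C * (1 + ∫ ω, Φ |X ω| ∂μ) - b) (by rw [hval X hX]; linarith)
    filter_upwards [h1, hCl.eventually (gt_mem_nhds (show C * (1 + ∫ ω, Φ |X ω| ∂μ) <
      C * (1 + ∫ ω, Φ |X ω| ∂μ) + (a - b) by linarith))] with n hn1 hn2
    rw [hval _ (hXn n)] at hn1
    linarith

lemma delta2_bound {Φ : ℝ → ℝ} (h : AuxYF Φ) {α : ℝ} (hα : α < 1)
    (hD : ∃ y : ℝ, 0 < y ∧ ∃ k : ℝ, 0 < k ∧ ∀ x : ℝ, y ≤ x → Φ (2 * x) < k * Φ x)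
    (m : ℝ) {l : ℝ} (hl : 0 < l) : ∃ C : ℝ, ∀ x, auxg Φ α m l x ≤ C * (1 + Φ |x|) := by
  obtain ⟨y, hy, k, hk, hD⟩ := hD
  have h1a : 0 < 1 - α := by linarith
  have hpow : ∀ (j : ℕ) (x : ℝ), y ≤ x → Φ (2 ^ j * x) ≤ k ^ j * Φ x := by
    intro j
    induction j with
    | zero => intro x _; simp
    | succ j ih =>
      intro x hx
      have h1 := ih (2 * x) (by linarith)
      have h2 := mul_le_mul_of_nonneg_left (hD x hx).le (pow_nonneg hk.le j)
      calc Φ (2 ^ (j + 1) * x) = Φ (2 ^ j * (2 * x)) := by rw [pow_succ]; congr 1; ring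
        _ ≤ _ := h1
        _ ≤ _ := h2
        _ = _ := by ring
  obtain ⟨j, hj⟩ := pow_unbounded_of_one_lt (2 / l) (by norm_num : (1:ℝ) < 2)
  have hm0 := h.nonneg (abs_nonneg m)
  have hy0 := h.nonneg hy.le
  refine ⟨k ^ j * (1 + Φ |m| + Φ y) / (1 - α), fun x => ?_⟩
  have hx0 := h.nonneg (abs_nonneg x)
  set z := max (max |x| |m|) y with hz
  have hzx : |x| ≤ z := (le_max_left _ _).trans (le_max_left _ _)
  have hzm : |m| ≤ z := (le_max_right _ _).trans (le_max_left _ _)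
  have hzy : y ≤ z := le_max_right _ _
  have hΦz : Φ z ≤ Φ |x| + Φ |m| + Φ y := by
    rcases max_choice (max |x| |m|) y with e | e
    · rcases max_choice |x| |m| with e' | e'
      · rw [hz, e, e']; linarith
      · rw [hz, e, e']; linarith
    · rw [hz, e]; linarith
  have h1 : |max (x - m) 0| / l ≤ 2 ^ j * z := by
    have : |max (x - m) 0| ≤ 2 * z := by
      rw [abs_of_nonneg (le_max_right _ _)]
      exact max_le (by linarith [le_abs_self x, neg_abs_le m]) (by linarith)
    calc |max (x - m) 0| / l ≤ 2 * z / l := div_le_div_of_nonneg_right this hl.le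
      _ = 2 / l * z := by ring
      _ ≤ _ := mul_le_mul_of_nonneg_right hj.le (by linarith)
  have h2 := (h.le (by positivity) h1).trans (hpow j z hzy)
  unfold auxg
  rw [div_mul_eq_mul_div]
  refine div_le_div_of_nonneg_right (h2.trans ?_) h1a.le
  rw [mul_assoc]
  refine mul_le_mul_of_nonneg_left ?_ (pow_nonneg hk.le j)
  nlinarith [mul_nonneg hm0 hx0, mul_nonneg hy0 hx0]

lemma auxJ_conv {Ω : Type*} [MeasurableSpace Ω] (μ : Measure Ω) [IsProbabilityMeasure μ]
    {Φ : ℝ → ℝ} (h : AuxYF Φ) {α : ℝ} (hα : α < 1)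
    (hD : ∃ y : ℝ, 0 < y ∧ ∃ k : ℝ, 0 < k ∧ ∀ x : ℝ, y ≤ x → Φ (2 * x) < k * Φ x)
    {Xn : ℕ → Ω → ℝ} {X : Ω → ℝ} (hX : MemYoung μ Φ X) (hXn : ∀ n, MemYoung μ Φ (Xn n))
    (hw : ∀ f : BoundedContinuousFunction ℝ ℝ,
          Tendsto (fun n => ∫ ω, f (Xn n ω) ∂μ) atTop (𝓝 (∫ ω, f (X ω) ∂μ)))
    (hE : Tendsto (fun n => ∫ ω, Φ |Xn n ω| ∂μ) atTop (𝓝 (∫ ω, Φ |X ω| ∂μ)))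
    (m : ℝ) {l : ℝ} (hl : 0 < l) :
    Tendsto (fun n => auxJ μ Φ α (Xn n) m l) atTop (𝓝 (auxJ μ Φ α X m l)) := by
  obtain ⟨C, hC⟩ := delta2_bound h hα hD m hl
  have hc := auxg_cont h α m hl
  have h0 := auxg_nonneg h hα m hl
  have hint : ∀ Y : Ω → ℝ, MemYoung μ Φ Y →
      auxJ μ Φ α Y m l = ENNReal.ofReal (∫ ω, auxg Φ α m l (Y ω) ∂μ) := by
    intro Y hY
    refine (ofReal_integral_eq_lintegral_ofReal ?_ (Eventually.of_forall (fun ω => h0 _))).symm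
    refine (((integrable_const 1).add (young_integrable μ h hY)).const_mul C).mono'
      (hc.measurable.comp hY.1).aestronglyMeasurable (Eventually.of_forall (fun ω => ?_))
    rw [Real.norm_eq_abs, abs_of_nonneg (h0 _)]
    exact hC _
  rw [hint X hX]
  simp_rw [fun n => hint (Xn n) (hXn n)]
  exact (ENNReal.continuous_ofReal.tendsto _).comp (aux_conv μ h hX hXn hw hE hc h0 hC)

lemma main_fwd {Ω : Type*} [MeasurableSpace Ω] (μ : Measure Ω) [IsProbabilityMeasure μ]
    {Φ : ℝ → ℝ} (h : AuxYF Φ) {α : ℝ} (hα0 : 0 < α) (hα : α < 1)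
    (hD : ∃ y : ℝ, 0 < y ∧ ∃ k : ℝ, 0 < k ∧ ∀ x : ℝ, y ≤ x → Φ (2 * x) < k * Φ x)
    {Xn : ℕ → Ω → ℝ} {X : Ω → ℝ} (hX : MemYoung μ Φ X) (hXn : ∀ n, MemYoung μ Φ (Xn n))
    (hw : ∀ f : BoundedContinuousFunction ℝ ℝ,
          Tendsto (fun n => ∫ ω, f (Xn n ω) ∂μ) atTop (𝓝 (∫ ω, f (X ω) ∂μ)))
    (hE : Tendsto (fun n => ∫ ω, Φ |Xn n ω| ∂μ) atTop (𝓝 (∫ ω, Φ |X ω| ∂μ))) :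
    Tendsto (fun n => piHG μ Φ α (Xn n)) atTop (𝓝 (piHG μ Φ α X)) := by
  have hconv := fun m l (hl : 0 < l) => auxJ_conv μ h hα hD hX hXn hw hE m hl
  rw [tendsto_order]
  constructor
  · intro a ha
    set π := piHG μ Φ α X with hπ
    obtain ⟨b, hab, hbπ⟩ := exists_between ha
    obtain ⟨δ, hδ⟩ : ∃ δ, δ = (π - b) / 2 := ⟨_, rfl⟩
    have hδ0 : 0 < δ := by rw [hδ]; linarith
    -- coercivity
    have hq : (0:ℝ) < 1 - α / 2 := by linarith
    obtain ⟨c, hc, hcq⟩ := exists_coer h (b := (1 - α) / (1 - α / 2))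
      (by rw [div_lt_one hq]; linarith)
    obtain ⟨K, hK⟩ := exists_tight μ (X := X) (q := 1 - α / 2) (by linarith)
    -- ramp function
    have hKn : ∀ᶠ n in atTop, 1 - α / 2 ≤ μ.real {ω | -(K + 1) ≤ Xn n ω} := by
      let f : ℝ → ℝ := fun x => max 0 (min 1 (x + K + 1))
      have hf0 : ∀ x, 0 ≤ f x := fun x => le_max_left _ _
      have hf1 : ∀ x, f x ≤ 1 := fun x => max_le zero_le_one (min_le_left _ _)
      have hfc : Continuous f := by fun_prop
      have hfi : ∀ Y : Ω → ℝ, Measurable Y → Integrable (fun ω => f (Y ω)) μ := by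
        intro Y hY
        refine (integrable_const (1:ℝ)).mono' (hfc.measurable.comp hY).aestronglyMeasurable
          (Eventually.of_forall (fun ω => ?_))
        rw [Real.norm_eq_abs, abs_of_nonneg (hf0 _)]
        exact hf1 _
      have hlow : 1 - α / 2 < ∫ ω, f (X ω) ∂μ := by
        refine hK.trans_le ?_
        rw [← integral_indicator_one (measurableSet_le measurable_const hX.1)]
        refine integral_mono_of_nonneg (Eventually.of_forall (fun ω => ?_)) (hfi X hX.1)
          (Eventually.of_forall (fun ω => ?_))
        · exact indicator_nonneg (fun _ _ => zero_le_one) _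
        · refine indicator_le' (fun ω hω => ?_) (fun ω _ => hf0 _) ω
          have h1 : -K ≤ X ω := hω
          show (1:ℝ) ≤ max 0 (min 1 (X ω + K + 1))
          exact le_max_of_le_right (le_min le_rfl (by linarith))
      filter_upwards [aux_lsc μ hX.1 (fun n => (hXn n).1) hw hfc hf0 (hfi X hX.1)
        (fun n => hfi _ (hXn n).1) hlow] with n hn
      refine hn.le.trans ?_
      have hms : MeasurableSet {ω | -(K + 1) ≤ Xn n ω} :=
        measurableSet_le measurable_const (hXn n).1
      rw [← integral_indicator_one hms]
      refine integral_mono_of_nonneg (Eventually.of_forall (fun ω => hf0 _))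
        ((integrable_const (1:ℝ)).indicator hms) (Eventually.of_forall (fun ω => ?_))
      by_cases hω : -(K + 1) ≤ Xn n ω
      · have : ω ∈ {ω | -(K + 1) ≤ Xn n ω} := hω
        simp only [indicator_of_mem this]
        exact hf1 _
      · have : ω ∉ {ω | -(K + 1) ≤ Xn n ω} := hω
        simp only [indicator_of_notMem this]
        push Not at hω
        refine max_le le_rfl ((min_le_right _ _).trans (by linarith))
    -- the lower cutoff
    obtain ⟨M, hM1, hM2⟩ : ∃ M : ℝ, K + 1 ≤ M ∧ b + c * (K + 1) ≤ (c - 1) * M := by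
      refine ⟨max (K + 1) ((b + c * (K + 1)) / (c - 1)), le_max_left _ _, ?_⟩
      have := le_max_right (K + 1) ((b + c * (K + 1)) / (c - 1))
      rw [div_le_iff₀ (by linarith)] at this
      linarith
    obtain ⟨I, hI⟩ := exists_nat_gt ((b + M) / δ)
    have hgrid : ∀ i ∈ Finset.range (I + 1), ∀ᶠ n in atTop,
        b + δ ≤ (-M + i * δ) + auxN μ Φ α (Xn n) (-M + i * δ) := by
      intro i _
      set mi := -M + i * δ
      have h1 : π ≤ mi + auxN μ Φ α X mi := by
        rw [hπ, piHG_eq]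
        exact ciInf_le (bddBelow_young μ h hα0 hα hX) mi
      rcases le_or_gt (b + δ - mi) 0 with hl | hl
      · refine Eventually.of_forall (fun n => ?_)
        linarith [auxN_nonneg μ Φ α (Xn n) mi]
      · have h2 : 1 < auxJ μ Φ α X mi (b + δ - mi) := by
          by_contra hcon
          have := auxN_le μ hl (not_lt.1 hcon)
          linarith
        filter_upwards [(hconv mi _ hl).eventually (lt_mem_nhds h2)] with n hn
        have := le_auxN μ h hα (young_nonempty μ h hα (hXn n) mi) hn
        linarith
    have hgrid' := (Finset.eventually_all (Finset.range (I + 1))).2 hgrid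
    filter_upwards [hKn, hgrid'] with n hn1 hn2
    refine hab.trans_le ?_
    rw [piHG_eq]
    refine le_ciInf (fun m => ?_)
    rcases lt_or_ge m (-M) with hm | hm
    · have := auxN_coer μ h hα (hXn n) hc hq hcq hn1 (m := m) (by linarith)
      nlinarith
    · rcases lt_or_ge b m with hm2 | hm2
      · linarith [auxN_nonneg μ Φ α (Xn n) m]
      · have hnn : 0 ≤ (m + M) / δ := div_nonneg (by linarith) hδ0.le
        have h1 := Nat.le_ceil ((m + M) / δ)
        have h2 := Nat.ceil_lt_add_one hnn
        have h3 : ⌈(m + M) / δ⌉₊ < I + 1 := by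
          have : ⌈(m + M) / δ⌉₊ ≤ I := by
            apply Nat.ceil_le.2
            exact (div_le_div_of_nonneg_right (by linarith) hδ0.le).trans hI.le
          omega
        have h4 := hn2 _ (Finset.mem_range.2 h3)
        rw [div_le_iff₀ hδ0] at h1
        have h5 : (⌈(m + M) / δ⌉₊ : ℝ) * δ < m + M + δ := by
          have := mul_lt_mul_of_pos_right h2 hδ0
          rwa [add_mul, div_mul_cancel₀ _ hδ0.ne', one_mul] at this
        have h6 := auxN_anti μ h hα (young_nonempty μ h hα (hXn n) m)
          (show m ≤ -M + (⌈(m + M) / δ⌉₊ : ℝ) * δ by linarith)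
        linarith
  · intro a ha
    rw [piHG_eq] at ha
    obtain ⟨m, hm⟩ := exists_lt_of_ciInf_lt ha
    have hlt : auxN μ Φ α X m < a - m := by linarith
    obtain ⟨l0, ⟨hl0, hJ0⟩, hl0lt⟩ := exists_lt_of_csInf_lt (young_nonempty μ h hα hX m) hlt
    obtain ⟨l, hl1, hl2⟩ := exists_between hl0lt
    have hl : 0 < l := hl0.trans hl1
    have hJ : auxJ μ Φ α X m l < 1 := by
      refine (auxJ_scale μ h hα X hl0 hl1.le).trans_lt ?_
      refine (mul_le_mul_right hJ0 _).trans_lt ?_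
      rw [mul_one, ENNReal.ofReal_lt_one, div_lt_one hl]
      exact hl1
    filter_upwards [(hconv m l hl).eventually (gt_mem_nhds hJ)] with n hn
    rw [piHG_eq]
    refine (ciInf_le (bddBelow_young μ h hα0 hα (hXn n)) m).trans_lt ?_
    have := auxN_le μ hl hn.le
    linarith

lemma heart_young {Ω : Type*} [MeasurableSpace Ω] {μ : Measure Ω} {Φ : ℝ → ℝ} {X : Ω → ℝ}
    (hX : MemHeart μ Φ X) : MemYoung μ Φ X := by
  refine ⟨hX.1, ?_⟩
  simpa using hX.2 1 one_pos

lemma ind_heart {Ω : Type*} [MeasurableSpace Ω] (μ : Measure Ω) [IsProbabilityMeasure μ]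
    {Φ : ℝ → ℝ} (h : AuxYF Φ) {A : Set Ω} (hA : MeasurableSet A) {x : ℝ} (hx : 0 ≤ x) :
    MemHeart μ Φ (A.indicator (fun _ => x)) := by
  refine ⟨measurable_const.indicator hA, fun l hl => ?_⟩
  have : ∫⁻ ω, ENNReal.ofReal (Φ (|A.indicator (fun _ => x) ω| / l)) ∂μ ≤
      ∫⁻ _, ENNReal.ofReal (Φ (x / l)) ∂μ := by
    refine lintegral_mono (fun ω => ENNReal.ofReal_le_ofReal (h.le (by positivity) ?_))
    refine div_le_div_of_nonneg_right ?_ hl.le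
    rw [abs_of_nonneg (indicator_nonneg (fun _ _ => hx) _)]
    exact indicator_le' (fun _ _ => le_rfl) (fun _ _ => hx) ω
  refine this.trans_lt ?_
  simp

lemma ind_integral {Ω : Type*} [MeasurableSpace Ω] (μ : Measure Ω) [IsProbabilityMeasure μ]
    {A : Set Ω} (hA : MeasurableSet A) (x : ℝ) (G : ℝ → ℝ) :
    ∫ ω, G (A.indicator (fun _ => x) ω) ∂μ = G 0 + μ.real A * (G x - G 0) := by
  have : (fun ω => G (A.indicator (fun _ => x) ω)) =
      fun ω => G 0 + A.indicator (fun _ => G x - G 0) ω := by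
    funext ω
    by_cases hω : ω ∈ A
    · simp [hω]
    · simp [hω]
  rw [this, integral_add (integrable_const _) ((integrable_const _).indicator hA),
    integral_indicator_const _ hA]
  simp

lemma ind_pi {Ω : Type*} [MeasurableSpace Ω] (μ : Measure Ω) [IsProbabilityMeasure μ]
    {Φ : ℝ → ℝ} (h : AuxYF Φ) {α : ℝ} (hα : α < 1) {c : ℝ} (hc : 1 < c)
    (hcα : 1 - α < Φ (1 / c)) {A : Set Ω} (hA : MeasurableSet A) {x : ℝ} (hx : 1 ≤ x)
    (hp : 1 - α < Φ (2 * x) * μ.real A) :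
    (c - 1) / (2 * c) ≤ piHG μ Φ α (A.indicator (fun _ => x)) := by
  have hc0 : 0 < c := by linarith
  obtain ⟨δ, hδ⟩ : ∃ δ, δ = (c - 1) / (2 * c) := ⟨_, rfl⟩
  rw [← hδ]
  have hδc : 2 * c * δ = c - 1 := by rw [hδ]; field_simp
  have hδ0 : 0 < δ := by rw [hδ]; exact div_pos (by linarith) (by linarith)
  have hδ2 : 2 * δ ≤ 1 := by nlinarith
  rw [piHG_eq]
  refine le_ciInf (fun m => ?_)
  rcases le_or_gt δ m with hm | hm
  · linarith [auxN_nonneg μ Φ α (A.indicator (fun _ => x)) m]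
  have hl : 0 < δ - m := by linarith
  have hne := young_nonempty μ h hα (heart_young (ind_heart μ h hA (by linarith : 0 ≤ x))) m
  suffices 1 < auxJ μ Φ α (A.indicator (fun _ => x)) m (δ - m) by
    have := le_auxN μ h hα hne this
    linarith
  by_cases hm2 : c * (δ - m) ≤ c * (-m) * c
  · refine auxJ_ge μ h hα MeasurableSet.univ hl (t := 1 / c) (by positivity) ?_ (by simpa using hcα)
    intro ω _
    have h0 : 0 ≤ A.indicator (fun _ => x) ω := indicator_nonneg (fun _ _ => by linarith) _
    have : 1 / c * (δ - m) ≤ -m := by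
      rw [one_div, inv_mul_eq_div, div_le_iff₀ hc0]
      nlinarith
    linarith
  · refine auxJ_ge μ h hα hA hl (t := 2 * x) (by linarith) ?_ hp
    intro ω hω
    rw [indicator_of_mem hω]
    push Not at hm2
    rcases le_or_gt 0 m with hm0 | hm0
    · nlinarith
    · have h1 : (-m) * c < δ - m := by nlinarith
      have h2 : 2 * (δ - m) ≤ 1 := by
        by_contra hcon
        push Not at hcon
        nlinarith
      nlinarith

lemma pi_zero {Ω : Type*} [MeasurableSpace Ω] (μ : Measure Ω) [IsProbabilityMeasure μ]
    {Φ : ℝ → ℝ} (h : AuxYF Φ) {α : ℝ} (hα0 : 0 < α) (hα : α < 1)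
    (hX : MemYoung μ Φ (fun _ : Ω => (0:ℝ))) : piHG μ Φ α (fun _ : Ω => (0:ℝ)) ≤ 0 := by
  rw [piHG_eq]
  refine (ciInf_le (bddBelow_young μ h hα0 hα hX) 0).trans ?_
  rw [zero_add]
  refine le_of_forall_pos_le_add (fun ε hε => ?_)
  rw [zero_add]
  refine auxN_le μ hε ?_
  simp [auxJ, auxg, h.zero]

lemma main_bwd {Ω : Type*} [MeasurableSpace Ω] (μ : Measure Ω) [IsProbabilityMeasure μ]
    (hNA : ∀ A : Set Ω, MeasurableSet A → 0 < μ A →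
      ∃ B : Set Ω, B ⊆ A ∧ MeasurableSet B ∧ 0 < μ B ∧ μ B < μ A)
    {Φ : ℝ → ℝ} (h : AuxYF Φ) {α : ℝ} (hα0 : 0 < α) (hα : α < 1)
    (hii : ∀ (Xn : ℕ → Ω → ℝ) (X : Ω → ℝ), (∀ n, MemHeart μ Φ (Xn n)) → MemHeart μ Φ X →
        (∀ f : BoundedContinuousFunction ℝ ℝ,
          Tendsto (fun n => ∫ ω, f (Xn n ω) ∂μ) atTop (𝓝 (∫ ω, f (X ω) ∂μ))) →
        Tendsto (fun n => ∫ ω, Φ |Xn n ω| ∂μ) atTop (𝓝 (∫ ω, Φ |X ω| ∂μ)) →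
        Tendsto (fun n => piHG μ Φ α (Xn n)) atTop (𝓝 (piHG μ Φ α X))) :
    ∃ y : ℝ, 0 < y ∧ ∃ k : ℝ, 0 < k ∧ ∀ x : ℝ, y ≤ x → Φ (2 * x) < k * Φ x := by
  by_contra hcon
  push Not at hcon
  have hx : ∀ n : ℕ, ∃ x : ℝ, (n : ℝ) + 1 ≤ x ∧ ((n : ℝ) + 1) * Φ x ≤ Φ (2 * x) :=
    fun n => hcon (n + 1) (by positivity) (n + 1) (by positivity)
  choose x hx1 hx2 using hx
  have hxone : ∀ n, 1 ≤ x n := fun n => by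
    have : (0:ℝ) ≤ n := Nat.cast_nonneg n
    linarith [hx1 n]
  have hΦ2 : ∀ n : ℕ, (n : ℝ) + 1 ≤ Φ (2 * x n) := fun n => by
    have := h.ge_self (x := 2 * x n) (by linarith [hxone n])
    linarith [hx1 n, hxone n]
  have hΦpos : ∀ n, 1 ≤ Φ (2 * x n) := fun n => by
    have : (0:ℝ) ≤ n := Nat.cast_nonneg n
    linarith [hΦ2 n]
  have hA : ∀ n, ∃ B : Set Ω, MeasurableSet B ∧ μ.real B = 1 / Φ (2 * x n) := fun n =>
    aux_sierpinski μ hNA _ (by have := hΦpos n; positivity)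
      (by rw [div_le_one (by linarith [hΦpos n])]; exact hΦpos n)
  choose A hAm hAp using hA
  have hlim0 : Tendsto (fun n : ℕ => 1 / ((n : ℝ) + 1)) atTop (𝓝 0) :=
    tendsto_one_div_add_atTop_nhds_zero_nat
  have hp : Tendsto (fun n => μ.real (A n)) atTop (𝓝 0) := by
    refine squeeze_zero (fun n => measureReal_nonneg) (fun n => ?_) hlim0
    rw [hAp]
    exact one_div_le_one_div_of_le (by positivity) (hΦ2 n)
  have hpΦ : Tendsto (fun n => μ.real (A n) * Φ (x n)) atTop (𝓝 0) := by
    refine squeeze_zero (fun n => mul_nonneg measureReal_nonneg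
      (h.nonneg (by linarith [hxone n]))) (fun n => ?_) hlim0
    have h0 : 0 < Φ (2 * x n) := by linarith [hΦpos n]
    rw [hAp, div_mul_eq_mul_div, one_mul, div_le_div_iff₀ h0 (by positivity)]
    linarith [hx2 n]
  have hX0 : MemHeart μ Φ (fun _ : Ω => (0:ℝ)) := by
    have := ind_heart μ h (MeasurableSet.empty (α := Ω)) (x := 0) le_rfl
    simpa using this
  have key := hii (fun n => (A n).indicator (fun _ => x n)) (fun _ => 0)
    (fun n => ind_heart μ h (hAm n) (by linarith [hxone n])) hX0 ?_ ?_
  · obtain ⟨c, hc, hcα⟩ := exists_coer h (b := 1 - α) (by linarith)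
    have h1 : (c - 1) / (2 * c) ≤ piHG μ Φ α (fun _ : Ω => (0:ℝ)) := by
      refine ge_of_tendsto' key (fun n => ind_pi μ h hα hc hcα (hAm n) (hxone n) ?_)
      rw [hAp, mul_one_div, div_self (by linarith [hΦpos n])]
      linarith
    have h2 := pi_zero μ h hα0 hα (heart_young hX0)
    have h3 : 0 < (c - 1) / (2 * c) := div_pos (by linarith) (by linarith)
    linarith
  · intro f
    simp_rw [fun n => ind_integral μ (hAm n) (x n) f]
    have e : ∫ _ : Ω, f 0 ∂μ = f 0 + 0 := by simp
    rw [e]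
    refine tendsto_const_nhds.add ?_
    refine squeeze_zero_norm (a := fun n => μ.real (A n) * (‖f‖ + ‖f‖)) (fun n => ?_) ?_
    · rw [norm_mul, Real.norm_of_nonneg measureReal_nonneg]
      refine mul_le_mul_of_nonneg_left ?_ measureReal_nonneg
      exact (norm_sub_le _ _).trans (add_le_add (f.norm_coe_le_norm _) (f.norm_coe_le_norm _))
    · simpa using hp.mul_const (‖f‖ + ‖f‖)
  · simp_rw [fun n => ind_integral μ (hAm n) (x n) (fun y => Φ |y|)]
    simp only [abs_zero, h.zero, integral_zero, zero_add, sub_zero]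
    refine hpΦ.congr (fun n => ?_)
    rw [abs_of_nonneg (by linarith [hxone n])]

/-- The following are equivalent: (i) `π_α` is continuous on the Young class `Y^Φ` with
respect to `Φ`-convergence in distribution; (ii) `π_α` is continuous on the Orlicz heart
`H^Φ` with respect to `Φ`-convergence in distribution; (iii) `Φ` satisfies the `Δ₂`
condition. -/
theorem stmt_12 {Ω : Type*} [MeasurableSpace Ω] (μ : Measure Ω) [IsProbabilityMeasure μ]
    (hNA : ∀ A : Set Ω, MeasurableSet A → 0 < μ A →
      ∃ B : Set Ω, B ⊆ A ∧ MeasurableSet B ∧ 0 < μ B ∧ μ B < μ A)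
    (Φ : ℝ → ℝ) (hΦ0 : Φ 0 = 0) (hΦ1 : Φ 1 = 1)
    (hΦmono : MonotoneOn Φ (Ici 0)) (hΦconv : ConvexOn ℝ (Ici 0) Φ)
    (α : ℝ) (hα : α ∈ Ioo (0 : ℝ) 1) :
    -- (i) ↔ (ii)
    ((∀ (Xn : ℕ → Ω → ℝ) (X : Ω → ℝ), (∀ n, MemYoung μ Φ (Xn n)) → MemYoung μ Φ X →
        (∀ f : BoundedContinuousFunction ℝ ℝ,
          Tendsto (fun n => ∫ ω, f (Xn n ω) ∂μ) atTop (𝓝 (∫ ω, f (X ω) ∂μ))) →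
        Tendsto (fun n => ∫ ω, Φ |Xn n ω| ∂μ) atTop (𝓝 (∫ ω, Φ |X ω| ∂μ)) →
        Tendsto (fun n => piHG μ Φ α (Xn n)) atTop (𝓝 (piHG μ Φ α X))) ↔
      (∀ (Xn : ℕ → Ω → ℝ) (X : Ω → ℝ), (∀ n, MemHeart μ Φ (Xn n)) → MemHeart μ Φ X →
        (∀ f : BoundedContinuousFunction ℝ ℝ,
          Tendsto (fun n => ∫ ω, f (Xn n ω) ∂μ) atTop (𝓝 (∫ ω, f (X ω) ∂μ))) →
        Tendsto (fun n => ∫ ω, Φ |Xn n ω| ∂μ) atTop (𝓝 (∫ ω, Φ |X ω| ∂μ)) →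
        Tendsto (fun n => piHG μ Φ α (Xn n)) atTop (𝓝 (piHG μ Φ α X)))) ∧
    -- (ii) ↔ (iii)
    ((∀ (Xn : ℕ → Ω → ℝ) (X : Ω → ℝ), (∀ n, MemHeart μ Φ (Xn n)) → MemHeart μ Φ X →
        (∀ f : BoundedContinuousFunction ℝ ℝ,
          Tendsto (fun n => ∫ ω, f (Xn n ω) ∂μ) atTop (𝓝 (∫ ω, f (X ω) ∂μ))) →
        Tendsto (fun n => ∫ ω, Φ |Xn n ω| ∂μ) atTop (𝓝 (∫ ω, Φ |X ω| ∂μ)) →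
        Tendsto (fun n => piHG μ Φ α (Xn n)) atTop (𝓝 (piHG μ Φ α X))) ↔
      (∃ y : ℝ, 0 < y ∧ ∃ k : ℝ, 0 < k ∧ ∀ x : ℝ, y ≤ x → Φ (2 * x) < k * Φ x)) := by
  have h : AuxYF Φ := ⟨hΦ0, hΦ1, hΦmono, hΦconv⟩
  have hres : (∀ (Xn : ℕ → Ω → ℝ) (X : Ω → ℝ), (∀ n, MemYoung μ Φ (Xn n)) → MemYoung μ Φ X →
        (∀ f : BoundedContinuousFunction ℝ ℝ,
          Tendsto (fun n => ∫ ω, f (Xn n ω) ∂μ) atTop (𝓝 (∫ ω, f (X ω) ∂μ))) →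
        Tendsto (fun n => ∫ ω, Φ |Xn n ω| ∂μ) atTop (𝓝 (∫ ω, Φ |X ω| ∂μ)) →
        Tendsto (fun n => piHG μ Φ α (Xn n)) atTop (𝓝 (piHG μ Φ α X))) →
      (∀ (Xn : ℕ → Ω → ℝ) (X : Ω → ℝ), (∀ n, MemHeart μ Φ (Xn n)) → MemHeart μ Φ X →
        (∀ f : BoundedContinuousFunction ℝ ℝ,
          Tendsto (fun n => ∫ ω, f (Xn n ω) ∂μ) atTop (𝓝 (∫ ω, f (X ω) ∂μ))) →
        Tendsto (fun n => ∫ ω, Φ |Xn n ω| ∂μ) atTop (𝓝 (∫ ω, Φ |X ω| ∂μ)) →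
        Tendsto (fun n => piHG μ Φ α (Xn n)) atTop (𝓝 (piHG μ Φ α X))) :=
    fun H Xn X hXn hX => H Xn X (fun n => heart_young (hXn n)) (heart_young hX)
  refine ⟨⟨hres, fun H => ?_⟩, ⟨fun H => main_bwd μ hNA h hα.1 hα.2 H, fun hD => hres ?_⟩⟩
  · intro Xn X hXn hX hw hE
    exact main_fwd μ h hα.1 hα.2 (main_bwd μ hNA h hα.1 hα.2 H) hX hXn hw hE
  · intro Xn X hXn hX hw hE
    exact main_fwd μ h hα.1 hα.2 hD hX hXn hw hE
end

section
/- The Haezendonck–Goovaerts premium principle π_α is never continuous with respect to convergence in distribution: if (A_n) is a sequence of measurable sets with ℙ(A_n) = 1/n and X_n := n·1_{A_n}, then X_n → 0 in distribution while π_α(X_n) ≥ E[X_n] = 1 for every n; in particular π_α(X_n) does not converge to π_α(0) = 0. -/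
open MeasureTheory Filter Set Topology

lemma hg_support (Φ : ℝ → ℝ) (hΦ0 : Φ 0 = 0) (hΦ1 : Φ 1 = 1)
    (hΦconv : ConvexOn ℝ (Ici 0) Φ) :
    ∃ s : ℝ, 1 ≤ s ∧ ∀ x, 0 ≤ x → 1 + s * (x - 1) ≤ Φ x := by
  have key := exists_between_of_forall_le
    (s := (fun x => (1 - Φ x) / (1 - x)) '' Ico 0 1)
    (t := (fun x => (Φ x - 1) / (x - 1)) '' Ioi 1)
    ⟨_, 0, by simp, rfl⟩ ⟨_, 2, by simp, rfl⟩ ?_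
  · obtain ⟨s, hs1, hs2⟩ := key
    have hs1' : ∀ x, 0 ≤ x → x < 1 → (1 - Φ x) / (1 - x) ≤ s :=
      fun x h0 h1 => hs1 ⟨x, ⟨h0, h1⟩, rfl⟩
    have hs2' : ∀ x, 1 < x → s ≤ (Φ x - 1) / (x - 1) := fun x h1 => hs2 ⟨x, h1, rfl⟩
    refine ⟨s, ?_, ?_⟩
    · have := hs1' 0 le_rfl one_pos
      simpa [hΦ0] using this
    · intro x hx
      rcases lt_trichotomy x 1 with h | h | h
      · have := hs1' x hx h
        rw [div_le_iff₀ (by linarith)] at this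
        linarith
      · subst h; simp [hΦ1]
      · have := hs2' x h
        rw [le_div_iff₀ (by linarith)] at this
        linarith
  · rintro _ ⟨x, hx, rfl⟩ _ ⟨y, hy, rfl⟩
    have hy' : (1 : ℝ) < y := hy
    have := hΦconv.slope_mono_adjacent (x := x) (y := 1) (z := y) hx.1
      (show (0 : ℝ) ≤ y by linarith) hx.2 hy'
    simpa [hΦ1] using this

lemma hg_lux_ge {Ω : Type*} [MeasurableSpace Ω] (μ : Measure Ω) [IsProbabilityMeasure μ]
    (Φ : ℝ → ℝ) (hΦ0 : Φ 0 = 0) (hΦ1 : Φ 1 = 1)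
    (hΦmono : MonotoneOn Φ (Ici 0)) (hΦconv : ConvexOn ℝ (Ici 0) Φ)
    (α : ℝ) (hα : α ∈ Ioo (0 : ℝ) 1) (Y : Ω → ℝ) (hY : Measurable Y)
    (hY0 : ∀ ω, 0 ≤ Y ω) (C : ℝ) (hC : ∀ ω, Y ω ≤ C) :
    ∫ ω, Y ω ∂μ ≤ luxNorm μ (fun x => Φ x / (1 - α)) Y := by
  obtain ⟨s, hs, hsup⟩ := hg_support Φ hΦ0 hΦ1 hΦconv
  have ha : 0 < 1 - α := by linarith [hα.2]
  have hΦnn : ∀ x, 0 ≤ x → 0 ≤ Φ x := fun x hx => by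
    have := hΦmono (show (0 : ℝ) ∈ Ici 0 by simp) (show x ∈ Ici 0 from hx) hx
    linarith
  have hYi : Integrable Y μ := Integrable.of_bound hY.aestronglyMeasurable C
    (Eventually.of_forall fun ω => by rw [Real.norm_eq_abs, abs_of_nonneg (hY0 ω)]; exact hC ω)
  apply le_csInf
  · have hM : 0 < max C 1 := by positivity
    refine ⟨max C 1 / (1 - α), by positivity, ?_⟩
    have hb : ∀ ω, ENNReal.ofReal (Φ (|Y ω| / (max C 1 / (1 - α))) / (1 - α)) ≤ 1 := by
      intro ω
      rw [ENNReal.ofReal_le_one, div_le_one ha, abs_of_nonneg (hY0 ω)]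
      have h1 : Y ω / (max C 1 / (1 - α)) ≤ 1 - α := by
        rw [div_le_iff₀ (by positivity), mul_div_cancel₀ _ ha.ne']
        exact (hC ω).trans (le_max_left _ _)
      have h2 : Φ (1 - α) ≤ 1 - α := by
        have := hΦconv.2 (show (0 : ℝ) ∈ Ici 0 by simp) (show (1 : ℝ) ∈ Ici 0 by simp)
          hα.1.le ha.le (by ring)
        simpa [hΦ0, hΦ1] using this
      refine (hΦmono ?_ ha.le h1).trans h2
      have := hY0 ω
      exact div_nonneg this (by positivity)
    calc _ ≤ ∫⁻ ω, 1 ∂μ := lintegral_mono hb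
      _ = 1 := by simp
  · rintro l ⟨hl, hint⟩
    have hgi : Integrable (fun ω => 1 + s * (Y ω / l - 1)) μ :=
      (integrable_const _).add (((hYi.div_const l).sub (integrable_const _)).const_mul s)
    have hle : ∫ ω, (1 + s * (Y ω / l - 1)) ∂μ ≤ 1 := by
      calc _ ≤ ∫ ω, max (1 + s * (Y ω / l - 1)) 0 ∂μ :=
            integral_mono hgi hgi.pos_part fun ω => le_max_left _ _
        _ ≤ 1 := by
            rw [← ENNReal.ofReal_le_one, ofReal_integral_eq_lintegral_ofReal hgi.pos_part
              (Eventually.of_forall fun ω => le_max_right _ _)]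
            refine (lintegral_mono fun ω => ?_).trans hint
            apply ENNReal.ofReal_le_ofReal
            have h0 : 0 ≤ Y ω / l := div_nonneg (hY0 ω) hl.le
            rw [abs_of_nonneg (hY0 ω)]
            have h1 := hΦnn _ h0
            apply max_le
            · refine (hsup _ h0).trans ?_
              rw [le_div_iff₀ ha]
              nlinarith [hα.1]
            · positivity
    have hcalc : ∫ ω, (1 + s * (Y ω / l - 1)) ∂μ = 1 + s * ((∫ ω, Y ω ∂μ) / l - 1) := by
      have hi2 : Integrable (fun ω => s * (Y ω / l - 1)) μ :=
        ((hYi.div_const l).sub (integrable_const _)).const_mul s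
      rw [integral_add (integrable_const _) hi2, integral_const_mul,
        integral_sub (hYi.div_const l) (integrable_const _), integral_div]
      simp
    rw [hcalc] at hle
    have : (∫ ω, Y ω ∂μ) / l ≤ 1 := by
      by_contra h
      push Not at h
      nlinarith
    rwa [div_le_one hl] at this

lemma hg_ge {Ω : Type*} [MeasurableSpace Ω] (μ : Measure Ω) [IsProbabilityMeasure μ]
    (Φ : ℝ → ℝ) (hΦ0 : Φ 0 = 0) (hΦ1 : Φ 1 = 1)
    (hΦmono : MonotoneOn Φ (Ici 0)) (hΦconv : ConvexOn ℝ (Ici 0) Φ)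
    (α : ℝ) (hα : α ∈ Ioo (0 : ℝ) 1) (X : Ω → ℝ) (hX : Measurable X)
    (hX0 : ∀ ω, 0 ≤ X ω) (C : ℝ) (hC : ∀ ω, X ω ≤ C) (m : ℝ) :
    ∫ ω, X ω ∂μ ≤ m + luxNorm μ (fun x => Φ x / (1 - α)) (fun ω => max (X ω - m) 0) := by
  have hXi : Integrable X μ := Integrable.of_bound hX.aestronglyMeasurable C
    (Eventually.of_forall fun ω => by rw [Real.norm_eq_abs, abs_of_nonneg (hX0 ω)]; exact hC ω)
  have h1 := hg_lux_ge μ Φ hΦ0 hΦ1 hΦmono hΦconv α hα (fun ω => max (X ω - m) 0)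
    ((hX.sub_const m).max measurable_const) (fun ω => le_max_right _ _) (max (C - m) 0)
    (fun ω => max_le_max (by linarith [hC ω]) le_rfl)
  have hi : Integrable (fun ω => X ω - m) μ := hXi.sub (integrable_const m)
  have h2 : ∫ ω, (X ω - m) ∂μ ≤ ∫ ω, max (X ω - m) 0 ∂μ :=
    integral_mono hi hi.pos_part fun ω => le_max_left _ _
  rw [integral_sub hXi (integrable_const m)] at h2
  simp at h2
  linarith

/-- `π_α` is never continuous with respect to convergence in distribution: for
`X_n = n·1_{A_n}` with `ℙ(A_n) = 1/n`, one has `X_n → 0` in distribution, yet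
`E[X_n] = 1` and `π_α(X_n) ≥ E[X_n] = 1` for every `n ≥ 1`, while `π_α(0) = 0`; in
particular `π_α(X_n)` does not converge to `π_α(0)`. -/
theorem stmt_13 {Ω : Type*} [MeasurableSpace Ω] (μ : Measure Ω) [IsProbabilityMeasure μ]
    (hNA : ∀ A : Set Ω, MeasurableSet A → 0 < μ A →
      ∃ B : Set Ω, B ⊆ A ∧ MeasurableSet B ∧ 0 < μ B ∧ μ B < μ A)
    (Φ : ℝ → ℝ) (hΦ0 : Φ 0 = 0) (hΦ1 : Φ 1 = 1)
    (hΦmono : MonotoneOn Φ (Ici 0)) (hΦconv : ConvexOn ℝ (Ici 0) Φ)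
    (α : ℝ) (hα : α ∈ Ioo (0 : ℝ) 1)
    (A : ℕ → Set Ω) (hAmeas : ∀ n, MeasurableSet (A n))
    (hA : ∀ n : ℕ, 1 ≤ n → μ (A n) = 1 / (n : ENNReal)) :
    -- `X_n → 0` in distribution
    (∀ f : BoundedContinuousFunction ℝ ℝ,
      Tendsto (fun n : ℕ => ∫ ω, f ((n : ℝ) * (A n).indicator (fun _ => (1 : ℝ)) ω) ∂μ)
        atTop (𝓝 (∫ _ω, f 0 ∂μ))) ∧
    -- `E[X_n] = 1` and `π_α(X_n) ≥ 1` for `n ≥ 1`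
    (∀ n : ℕ, 1 ≤ n →
      (∫ ω, (n : ℝ) * (A n).indicator (fun _ => (1 : ℝ)) ω ∂μ) = 1 ∧
      1 ≤ piHG μ Φ α (fun ω => (n : ℝ) * (A n).indicator (fun _ => (1 : ℝ)) ω)) ∧
    -- `π_α(0) = 0`
    piHG μ Φ α (fun _ => (0 : ℝ)) = 0 ∧
    -- `π_α(X_n)` does not converge to `π_α(0)`
    ¬ Tendsto (fun n : ℕ => piHG μ Φ α (fun ω => (n : ℝ) * (A n).indicator (fun _ => (1 : ℝ)) ω))
        atTop (𝓝 (piHG μ Φ α (fun _ => (0 : ℝ)))) := by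
  have hreal : ∀ n : ℕ, 1 ≤ n → μ.real (A n) = 1 / (n : ℝ) := fun n hn => by
    simp [Measure.real, hA n hn]
  have hE : ∀ n : ℕ, 1 ≤ n →
      (∫ ω, (n : ℝ) * (A n).indicator (fun _ => (1 : ℝ)) ω ∂μ) = 1 := fun n hn => by
    have hn' : (n : ℝ) ≠ 0 := by positivity
    rw [integral_const_mul, integral_indicator_const _ (hAmeas n), hreal n hn]
    simp [hn']
  have hge : ∀ n : ℕ, 1 ≤ n →
      1 ≤ piHG μ Φ α (fun ω => (n : ℝ) * (A n).indicator (fun _ => (1 : ℝ)) ω) := fun n hn => by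
    apply le_ciInf
    intro m
    refine (hE n hn).ge.trans ?_
    refine hg_ge μ Φ hΦ0 hΦ1 hΦmono hΦconv α hα _ ?_ ?_ n ?_ m
    · exact (measurable_const.indicator (hAmeas n)).const_mul _
    · intro ω
      by_cases h : ω ∈ A n <;> simp [h]
    · intro ω
      by_cases h : ω ∈ A n <;> simp [h]
  have h0 : piHG μ Φ α (fun _ => (0 : ℝ)) = 0 := by
    have hlow := hg_ge μ Φ hΦ0 hΦ1 hΦmono hΦconv α hα (fun _ => (0 : ℝ)) measurable_const
      (fun _ => le_rfl) 0 (fun _ => le_rfl)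
    simp only [integral_zero] at hlow
    apply le_antisymm
    · refine (ciInf_le ⟨0, ?_⟩ (0 : ℝ)).trans ?_
      · rintro _ ⟨m, rfl⟩
        exact hlow m
      · have : {l : ℝ | 0 < l} = Ioi 0 := rfl
        simp [luxNorm, hΦ0, this]
    · exact le_ciInf hlow
  refine ⟨?_, fun n hn => ⟨hE n hn, hge n hn⟩, h0, ?_⟩
  · intro f
    have hval : ∀ n : ℕ, 1 ≤ n →
        ∫ ω, f ((n : ℝ) * (A n).indicator (fun _ => (1 : ℝ)) ω) ∂μ
          = f 0 + (1 / (n : ℝ)) * (f n - f 0) := fun n hn => by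
      have : (fun ω => f ((n : ℝ) * (A n).indicator (fun _ => (1 : ℝ)) ω))
          = fun ω => f 0 + (A n).indicator (fun _ => f n - f 0) ω := by
        funext ω
        by_cases h : ω ∈ A n <;> simp [h]
      rw [this, integral_add (integrable_const _)
        ((integrable_const _).indicator (hAmeas n)), integral_indicator_const _ (hAmeas n),
        hreal n hn]
      simp
    have hz : Tendsto (fun n : ℕ => (1 / (n : ℝ)) * (f n - f 0)) atTop (𝓝 0) := by
      refine squeeze_zero_norm (a := fun n : ℕ => (1 / (n : ℝ)) * (2 * ‖f‖)) (fun n => ?_) ?_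
      · rw [norm_mul, ← dist_eq_norm (f n), Real.norm_of_nonneg (by positivity)]
        gcongr
        exact f.dist_le_two_norm _ _
      · simpa using tendsto_one_div_atTop_nhds_zero_nat.mul_const (2 * ‖f‖)
    have hz2 := hz.const_add (f 0)
    have hc : ∫ _ω, f 0 ∂μ = f 0 + 0 := by simp
    rw [hc]
    refine hz2.congr' ?_
    filter_upwards [eventually_ge_atTop 1] with n hn
    exact (hval n hn).symm
  · intro h
    rw [h0] at h
    have : (1 : ℝ) ≤ 0 := ge_of_tendsto h (by
      filter_upwards [eventually_ge_atTop 1] with n hn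
      exact hge n hn)
    linarith
end

section
/- For the Haezendonck–Goovaerts premium principle π_α the following statements are equivalent: (a) π_α is lower semicontinuous with respect to convergence in distribution, i.e. for every sequence (X_n) ⊂ L^Φ and every X ∈ L^Φ, X_n → X in distribution implies π_α(X) ≤ liminf_n π_α(X_n); (b) π_α satisfies the super Fatou property, i.e. for every sequence (X_n) ⊂ L^Φ and every X ∈ L^Φ, X_n → X almost surely implies π_α(X) ≤ liminf_n π_α(X_n). -/
open MeasureTheory Filter Set Topology

section HGHelpers

lemma hg_mono {Φ : ℝ → ℝ} (hΦmono : MonotoneOn Φ (Ici 0)) :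
    Monotone (fun x => Φ (max x 0)) := by
  intro x y hxy
  exact hΦmono (by simp) (by simp) (max_le_max_right 0 hxy)

lemma hg_cont {Φ : ℝ → ℝ} (hΦmono : MonotoneOn Φ (Ici 0)) (hΦconv : ConvexOn ℝ (Ici 0) Φ) :
    Continuous (fun x => Φ (max x 0)) := by
  have hc : ConvexOn ℝ univ (fun x => Φ (max x 0)) := by
    refine ⟨convex_univ, ?_⟩
    intro x _ y _ a b ha hb hab
    have h1 := hΦconv.2 (x := max x 0) (by simp) (y := max y 0) (by simp) ha hb hab
    refine le_trans (hΦmono (by simp) ?_ ?_) h1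
    · simp only [smul_eq_mul, mem_Ici]; positivity
    · simp only [smul_eq_mul]
      apply max_le
      · gcongr <;> simp
      · positivity
  exact continuousOn_univ.1 (hc.continuousOn isOpen_univ)

lemma hg_rw {x m l : ℝ} (hl : 0 < l) : |max (x - m) 0| / l = max ((x - m) / l) 0 := by
  rw [abs_of_nonneg (le_max_right _ _), ← max_div_div_right hl.le, zero_div]

/-- Modular condition. -/
def HGle {Ω : Type*} [MeasurableSpace Ω] (μ : Measure Ω) (Φ : ℝ → ℝ) (α : ℝ) (X : Ω → ℝ)
    (m l : ℝ) : Prop :=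
  ∫⁻ ω, ENNReal.ofReal (Φ (max ((X ω - m) / l) 0) / (1 - α)) ∂μ ≤ 1

variable {Ω : Type*} [MeasurableSpace Ω] {μ : Measure Ω} {Φ : ℝ → ℝ} {α : ℝ}

lemma hg_iff {X : Ω → ℝ} {m l : ℝ} (hl : 0 < l) :
    ∫⁻ ω, ENNReal.ofReal ((fun x => Φ x / (1 - α)) (|max (X ω - m) 0| / l)) ∂μ ≤ 1 ↔
      HGle μ Φ α X m l := by
  unfold HGle
  simp only [hg_rw hl]

lemma hg_lux_le {X : Ω → ℝ} {m l : ℝ} (hl : 0 < l) (h : HGle μ Φ α X m l) :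
    luxNorm μ (fun x => Φ x / (1 - α)) (fun ω => max (X ω - m) 0) ≤ l := by
  apply csInf_le
  · exact ⟨0, fun y hy => hy.1.le⟩
  · exact ⟨hl, (hg_iff hl).2 h⟩

lemma hg_lux_nonneg (X : Ω → ℝ) (m : ℝ) :
    0 ≤ luxNorm μ (fun x => Φ x / (1 - α)) (fun ω => max (X ω - m) 0) :=
  Real.sInf_nonneg (fun _ hy => hy.1.le)

lemma HGle.mono (hΦmono : MonotoneOn Φ (Ici 0)) (hα : α ∈ Ioo (0 : ℝ) 1) {X : Ω → ℝ} {m l l' : ℝ}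
    (hl : 0 < l) (hll : l ≤ l') (h : HGle μ Φ α X m l) : HGle μ Φ α X m l' := by
  refine le_trans (lintegral_mono fun ω => ?_) h
  have : 0 < 1 - α := by linarith [hα.2]
  apply ENNReal.ofReal_le_ofReal
  gcongr
  apply hΦmono (by simp) (by simp)
  apply max_le _ (le_max_right _ _)
  by_cases hx : 0 ≤ X ω - m
  · exact le_max_of_le_left (by gcongr)
  · push Not at hx
    exact le_max_of_le_right (div_nonpos_of_nonpos_of_nonneg hx.le (by linarith))

lemma hg_nonempty [IsProbabilityMeasure μ] (hΦ0 : Φ 0 = 0)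
    (hΦmono : MonotoneOn Φ (Ici 0)) (hΦconv : ConvexOn ℝ (Ici 0) Φ)
    (hα : α ∈ Ioo (0 : ℝ) 1) {X : Ω → ℝ} (hX : MemOrlicz μ Φ X) (m : ℝ) :
    ∃ l, 0 < l ∧ HGle μ Φ α X m l := by
  obtain ⟨hXm, l, hl, hfin⟩ := hX
  have h1α : 0 < 1 - α := by linarith [hα.2]
  have hpos : ∀ x, 0 ≤ x → 0 ≤ Φ x := fun x hx => by
    rw [← hΦ0]; exact hΦmono (by simp) hx hx
  set I := ∫⁻ ω, ENNReal.ofReal (Φ (|X ω| / l)) ∂μ with hI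
  set B := Φ (|m| / l) with hB
  have hB0 : 0 ≤ B := hpos _ (by positivity)
  set K : ℝ := (I.toReal + B) / (1 - α) + 1 with hK
  have hK1 : 1 ≤ K := by
    rw [hK]; have : 0 ≤ (I.toReal + B) / (1 - α) := by positivity
    linarith
  have hK0 : 0 < K := by linarith
  refine ⟨K * (2 * l), by positivity, ?_⟩
  unfold HGle
  have key : ∀ ω, Φ (max ((X ω - m) / (K * (2 * l))) 0) / (1 - α) ≤
      (1 / (K * (1 - α))) * (Φ (|X ω| / l) + B) := by
    intro ω
    have ha : Φ (max ((X ω - m) / (K * (2 * l))) 0) ≤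
        Φ ((1/(2*K)) * (|X ω| / l) + (1/(2*K)) * (|m| / l)) := by
      apply hΦmono (by simp) (by simp only [mem_Ici]; positivity)
      apply max_le _ (by positivity)
      have : (1/(2*K)) * (|X ω| / l) + (1/(2*K)) * (|m| / l) = (|X ω| + |m|) / (K * (2 * l)) := by
        field_simp
      rw [this]
      gcongr
      linarith [le_abs_self (X ω), neg_abs_le m]
    have hb : Φ ((1/K) * ((1/2) * (|X ω| / l) + (1/2) * (|m| / l))) ≤
        (1/K) * Φ ((1/2) * (|X ω| / l) + (1/2) * (|m| / l)) := by
      have := hΦconv.2 (x := (1/2) * (|X ω| / l) + (1/2) * (|m| / l))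
        (by simp only [mem_Ici]; positivity) (y := 0) (by simp)
        (show 0 ≤ 1/K by positivity)
        (show 0 ≤ 1 - 1/K by rw [sub_nonneg]; exact (div_le_one hK0).2 hK1) (by ring)
      simpa [hΦ0] using this
    have hc : Φ ((1/2) * (|X ω| / l) + (1/2) * (|m| / l)) ≤
        (1/2) * Φ (|X ω| / l) + (1/2) * B := by
      have := hΦconv.2 (x := |X ω| / l)
        (by simp only [mem_Ici]; positivity) (y := |m| / l) (by simp only [mem_Ici]; positivity)
        (show (0:ℝ) ≤ 1/2 by positivity) (show (0:ℝ) ≤ 1/2 by positivity) (by norm_num)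
      simpa using this
    have hd : (1/(2*K)) * (|X ω| / l) + (1/(2*K)) * (|m| / l)
      = (1/K) * ((1/2) * (|X ω| / l) + (1/2) * (|m| / l)) := by field_simp
    rw [hd] at ha
    have hA : 0 ≤ Φ (|X ω| / l) := hpos _ (by positivity)
    rw [div_le_iff₀ h1α]
    calc _ ≤ (1/K) * Φ ((1/2) * (|X ω| / l) + (1/2) * (|m| / l)) := ha.trans hb
      _ ≤ (1/K) * (Φ (|X ω| / l) + B) := by gcongr; linarith
      _ = _ := by field_simp
  calc _ ≤ ∫⁻ ω, ENNReal.ofReal (1 / (K * (1 - α))) *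
        (ENNReal.ofReal (Φ (|X ω| / l)) + ENNReal.ofReal B) ∂μ := by
        apply lintegral_mono
        intro ω
        beta_reduce
        rw [← ENNReal.ofReal_add (hpos _ (by positivity)) hB0, ← ENNReal.ofReal_mul (by positivity)]
        exact ENNReal.ofReal_le_ofReal (key ω)
    _ = ENNReal.ofReal (1 / (K * (1 - α))) * (I + ENNReal.ofReal B) := by
        rw [lintegral_const_mul' _ _ ENNReal.ofReal_ne_top, lintegral_add_right _ measurable_const]
        simp [hI]
    _ = ENNReal.ofReal ((1 / (K * (1 - α))) * (I.toReal + B)) := by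
        rw [ENNReal.ofReal_mul (by positivity), ENNReal.ofReal_add (by positivity) hB0,
          ENNReal.ofReal_toReal hfin.ne]
    _ ≤ 1 := by
        rw [ENNReal.ofReal_le_one, one_div, inv_mul_le_iff₀ (by positivity), hK]
        field_simp
        linarith

lemma hg_of_lt [IsProbabilityMeasure μ] (hΦ0 : Φ 0 = 0)
    (hΦmono : MonotoneOn Φ (Ici 0)) (hΦconv : ConvexOn ℝ (Ici 0) Φ)
    (hα : α ∈ Ioo (0 : ℝ) 1) {X : Ω → ℝ} (hX : MemOrlicz μ Φ X) {m c : ℝ}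
    (h : m + luxNorm μ (fun x => Φ x / (1 - α)) (fun ω => max (X ω - m) 0) < c) :
    m < c ∧ HGle μ Φ α X m (c - m) := by
  have h0 := hg_lux_nonneg (μ := μ) (Φ := Φ) (α := α) X m
  refine ⟨by linarith, ?_⟩
  obtain ⟨l0, hl0, hl0'⟩ := hg_nonempty hΦ0 hΦmono hΦconv hα hX m
  have h1 : luxNorm μ (fun x => Φ x / (1 - α)) (fun ω => max (X ω - m) 0) < c - m := by linarith
  obtain ⟨l, ⟨hl, hmod⟩, hlt⟩ := exists_lt_of_csInf_lt (by exact ⟨l0, hl0, (hg_iff hl0).2 hl0'⟩) h1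
  exact HGle.mono hΦmono hα hl hlt.le ((hg_iff hl).1 hmod)

/-- Testing the modular condition against a bounded continuous minorant. -/
lemma hg_test [IsProbabilityMeasure μ] (hα : α ∈ Ioo (0 : ℝ) 1) {X : Ω → ℝ} (hX : Measurable X)
    {m l : ℝ} (h : HGle μ Φ α X m l) (f : BoundedContinuousFunction ℝ ℝ)
    (hf0 : ∀ x, 0 ≤ f x) (hf : ∀ x, f x ≤ Φ (max ((x - m) / l) 0)) :
    ∫ ω, f (X ω) ∂μ ≤ 1 - α := by
  have h1α : 0 < 1 - α := by linarith [hα.2]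
  have e1 : (∫ ω, f (X ω) / (1 - α) ∂μ) ≤ 1 := by
    rw [integral_eq_lintegral_of_nonneg_ae]
    · refine ENNReal.toReal_le_of_le_ofReal zero_le_one ?_
      rw [ENNReal.ofReal_one]
      refine le_trans (lintegral_mono fun ω => ?_) h
      apply ENNReal.ofReal_le_ofReal
      gcongr
      exact hf _
    · exact Eventually.of_forall fun ω => div_nonneg (hf0 _) h1α.le
    · exact ((f.continuous.measurable.comp hX).div_const _).aestronglyMeasurable
  rw [integral_div, div_le_one h1α] at e1
  exact e1

lemma hg_coercive [IsProbabilityMeasure μ] (hΦ1 : Φ 1 = 1) (hΦ0 : Φ 0 = 0)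
    (hΦmono : MonotoneOn Φ (Ici 0)) (hΦconv : ConvexOn ℝ (Ici 0) Φ)
    (hα : α ∈ Ioo (0 : ℝ) 1) (c : ℝ) {Xn : ℕ → Ω → ℝ} {X : Ω → ℝ}
    (hXn : ∀ n, Measurable (Xn n)) (hX : Measurable X)
    (hd : ∀ f : BoundedContinuousFunction ℝ ℝ,
        Tendsto (fun n => ∫ ω, f (Xn n ω) ∂μ) atTop (𝓝 (∫ ω, f (X ω) ∂μ))) :
    ∃ M, ∀ᶠ n in atTop, ∀ m, m < c → HGle μ Φ α (Xn n) m (c - m) → M ≤ m := by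
  -- choose s
  obtain ⟨s, hs0, hs1, hs⟩ : ∃ s, 0 < s ∧ s < 1 ∧ 1 - α < Φ s := by
    have hc := (hg_cont hΦmono hΦconv).tendsto 1
    have h2 : ∀ᶠ x in 𝓝[<] (1:ℝ), 1 - α < Φ (max x 0) := by
      apply (tendsto_nhdsWithin_of_tendsto_nhds hc).eventually_const_lt
      simp [hΦ1, hα.1]
    have h3 : ∀ᶠ x in 𝓝[<] (1:ℝ), x ∈ Ioo (0:ℝ) 1 := Ioo_mem_nhdsLT zero_lt_one
    obtain ⟨s, h4, h5⟩ := (h2.and h3).exists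
    rw [max_eq_left h5.1.le] at h4
    exact ⟨s, h5.1, h5.2, h4⟩
  have hΦs : 0 < Φ s := by linarith [hα.2]
  -- test functions
  let f : ℕ → BoundedContinuousFunction ℝ ℝ := fun K =>
    BoundedContinuousFunction.ofNormedAddCommGroup
      (fun x => Φ s * max 0 (min 1 (x + K + 1))) (by fun_prop) (Φ s) (by
        intro x
        rw [Real.norm_of_nonneg (by positivity)]
        have : max 0 (min 1 (x + K + 1)) ≤ 1 := max_le zero_le_one (min_le_left _ _)
        nlinarith)
  have hfe : ∀ K x, f K x = Φ s * max 0 (min 1 (x + K + 1)) := fun K x => rfl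
  have hlim : Tendsto (fun K => ∫ ω, f K (X ω) ∂μ) atTop (𝓝 (∫ _ω, Φ s ∂μ)) := by
    apply tendsto_integral_of_dominated_convergence (fun _ => Φ s)
    · intro K
      exact ((f K).continuous.measurable.comp hX).aestronglyMeasurable
    · exact integrable_const _
    · intro K
      refine Eventually.of_forall fun ω => ?_
      rw [hfe, Real.norm_of_nonneg (by positivity)]
      have : max 0 (min 1 (X ω + K + 1)) ≤ 1 := max_le zero_le_one (min_le_left _ _)
      nlinarith
    · refine Eventually.of_forall fun ω => ?_
      apply tendsto_const_nhds.congr'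
      obtain ⟨N, hN⟩ := exists_nat_ge (- X ω)
      filter_upwards [eventually_ge_atTop N] with K hK
      have : (N:ℝ) ≤ K := by exact_mod_cast hK
      rw [hfe, min_eq_left (by linarith)]
      simp
  have hlim' : ∀ᶠ K in atTop, 1 - α < ∫ ω, f K (X ω) ∂μ := by
    apply hlim.eventually_const_lt
    simpa using hs
  obtain ⟨K, hK⟩ := hlim'.exists
  have hev := (hd (f K)).eventually_const_lt hK
  have h1s : 0 < 1 - s := by linarith
  refine ⟨-(K + 1 + s * c) / (1 - s), ?_⟩
  filter_upwards [hev] with n hn m hm hle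
  by_contra hcon
  push Not at hcon
  rw [lt_div_iff₀ h1s] at hcon
  refine absurd (hg_test hα (hXn n) hle (f K) ?_ ?_) (not_le.2 hn)
  · intro x; rw [hfe]; positivity
  · intro x
    rw [hfe]
    have hcm : 0 < c - m := by linarith
    by_cases hx : x + K + 1 ≤ 0
    · rw [max_eq_left ((min_le_right _ _).trans hx), mul_zero]
      exact hΦ0.symm.le.trans (hΦmono (by simp) (by simp) (le_max_right _ _))
    · push Not at hx
      have h6 : Φ s ≤ Φ (max ((x - m) / (c - m)) 0) := by
        apply hΦmono hs0.le (by simp)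
        apply le_max_of_le_left
        rw [le_div_iff₀ hcm]
        nlinarith
      have : max 0 (min 1 (x + K + 1)) ≤ 1 := max_le zero_le_one (min_le_left _ _)
      nlinarith

lemma hg_bdd [IsProbabilityMeasure μ] (hΦ1 : Φ 1 = 1) (hΦ0 : Φ 0 = 0)
    (hΦmono : MonotoneOn Φ (Ici 0)) (hΦconv : ConvexOn ℝ (Ici 0) Φ)
    (hα : α ∈ Ioo (0 : ℝ) 1) {X : Ω → ℝ} (hX : MemOrlicz μ Φ X) :
    BddBelow (range fun m : ℝ =>
      m + luxNorm μ (fun x => Φ x / (1 - α)) (fun ω => max (X ω - m) 0)) := by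
  obtain ⟨M, hM⟩ := hg_coercive (μ := μ) hΦ1 hΦ0 hΦmono hΦconv hα 0 (Xn := fun _ => X)
    (fun _ => hX.1) hX.1 (fun f => tendsto_const_nhds)
  obtain ⟨n, hn⟩ := hM.exists
  refine ⟨min M 0, ?_⟩
  rintro _ ⟨m, rfl⟩
  by_contra hcon
  push Not at hcon
  have h0 := hg_lux_nonneg (μ := μ) (Φ := Φ) (α := α) X m
  obtain ⟨h1, h2⟩ := hg_of_lt hΦ0 hΦmono hΦconv hα hX (lt_of_lt_of_le hcon (min_le_right _ _))
  have := hn m h1 h2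
  have := min_le_left M 0
  linarith

lemma hg_lsc [IsProbabilityMeasure μ] (hΦ1 : Φ 1 = 1) (hΦ0 : Φ 0 = 0)
    (hΦmono : MonotoneOn Φ (Ici 0)) (hΦconv : ConvexOn ℝ (Ici 0) Φ)
    (hα : α ∈ Ioo (0 : ℝ) 1) {Xn : ℕ → Ω → ℝ} {X : Ω → ℝ}
    (hXn : ∀ n, MemOrlicz μ Φ (Xn n)) (hX : MemOrlicz μ Φ X)
    (hd : ∀ f : BoundedContinuousFunction ℝ ℝ,
        Tendsto (fun n => ∫ ω, f (Xn n ω) ∂μ) atTop (𝓝 (∫ ω, f (X ω) ∂μ))) :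
    ((piHG μ Φ α X : ℝ) : EReal)
        ≤ Filter.liminf (fun n => ((piHG μ Φ α (Xn n) : ℝ) : EReal)) atTop := by
  have h1α : 0 < 1 - α := by linarith [hα.2]
  by_contra hcon
  push Not at hcon
  obtain ⟨c, hc1, hc2⟩ := EReal.lt_iff_exists_real_btwn.1 hcon
  have hc : c < piHG μ Φ α X := by exact_mod_cast hc2
  have hfr : ∃ᶠ n in atTop, piHG μ Φ α (Xn n) < c :=
    (frequently_lt_of_liminf_lt (by isBoundedDefault) hc1).mono fun n hn => by exact_mod_cast hn
  obtain ⟨M, hM⟩ := hg_coercive (μ := μ) hΦ1 hΦ0 hΦmono hΦconv hα c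
    (fun n => (hXn n).1) hX.1 hd
  have hfr2 : ∃ᶠ n in atTop, ∃ m, M ≤ m ∧ m < c ∧ HGle μ Φ α (Xn n) m (c - m) := by
    refine (hfr.and_eventually hM).mono ?_
    rintro n ⟨hn, hn'⟩
    obtain ⟨m, hm⟩ := exists_lt_of_ciInf_lt hn
    obtain ⟨h1, h2⟩ := hg_of_lt hΦ0 hΦmono hΦconv hα (hXn n) hm
    exact ⟨m, hn' m h1 h2, h1, h2⟩
  set P : ℕ → Prop := fun n => ∃ m, M ≤ m ∧ m < c ∧ HGle μ Φ α (Xn n) m (c - m) with hP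
  have : ∀ n, ∃ m, P n → (M ≤ m ∧ m < c ∧ HGle μ Φ α (Xn n) m (c - m)) := by
    intro n
    by_cases h : P n
    · obtain ⟨m, hm⟩ := h
      exact ⟨m, fun _ => hm⟩
    · exact ⟨0, fun h' => absurd h' h⟩
  choose u hu using this
  let L : Filter ℕ := atTop ⊓ 𝓟 {n | P n}
  have hLne : L.NeBot := frequently_mem_iff_neBot.1 hfr2
  have hLP : ∀ᶠ n in L, P n := mem_inf_of_right (mem_principal_self _)
  obtain ⟨m, hm, hclus⟩ := (isCompact_Icc (a := M) (b := c)).exists_mapClusterPt (f := L) (u := u)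
    (by
      rw [le_principal_iff, mem_map]
      filter_upwards [hLP] with n hn
      exact ⟨(hu n hn).1, (hu n hn).2.1.le⟩)
  set ε : ℝ := (piHG μ Φ α X - c) / 3 with hε
  have hε0 : 0 < ε := by rw [hε]; linarith
  have hball : ∃ᶠ n in L, u n ∈ Metric.ball m ε :=
    hclus.frequently (Metric.ball_mem_nhds m hε0)
  have hl : 0 < c - m + ε := by linarith [hm.2]
  have hF := hg_cont hΦmono hΦconv
  have hpos : ∀ x, 0 ≤ Φ (max x 0) := fun x => by
    nth_rewrite 1 [← hΦ0]; exact hΦmono (by simp) (by simp) (le_max_right _ _)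
  let f : ℕ → BoundedContinuousFunction ℝ ℝ := fun K =>
    BoundedContinuousFunction.ofNormedAddCommGroup
      (fun x => min (K : ℝ) (Φ (max ((x - (m + ε)) / (c - m + ε)) 0)))
      (continuous_const.min (hF.comp (by fun_prop : Continuous
        fun x : ℝ => (x - (m + ε)) / (c - m + ε)))) K (by
        intro x
        rw [Real.norm_of_nonneg (le_min (by positivity) (hpos _))]
        exact min_le_left _ _)
  have hfe : ∀ K x, f K x = min (K : ℝ) (Φ (max ((x - (m + ε)) / (c - m + ε)) 0)) :=
    fun K x => rfl
  have hf0 : ∀ K x, 0 ≤ f K x := fun K x => le_min (by positivity) (hpos _)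
  have hint : ∀ K, ∫ ω, f K (X ω) ∂μ ≤ 1 - α := by
    intro K
    have ht := (hd (f K)).mono_left (inf_le_left : L ≤ atTop)
    refine le_of_tendsto_of_frequently ht ?_
    refine (hball.and_eventually hLP).mono ?_
    rintro n ⟨hn, hn'⟩
    obtain ⟨h1, h2, h3⟩ := hu n hn'
    rw [Metric.mem_ball, Real.dist_eq, abs_lt] at hn
    refine hg_test hα (hXn n).1 h3 (f K) (hf0 K) ?_
    intro x
    rw [hfe]
    refine (min_le_right _ _).trans (hΦmono (by simp) (by simp) ?_)
    apply max_le _ (le_max_right _ _)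
    by_cases hx : 0 ≤ x - (m + ε)
    · refine le_max_of_le_left ?_
      apply div_le_div₀ <;> linarith
    · push Not at hx
      exact le_max_of_le_right (div_nonpos_of_nonpos_of_nonneg hx.le hl.le)
  have hle : HGle μ Φ α X (m + ε) (c - m + ε) := by
    have hmeas : ∀ K, Measurable fun ω => ENNReal.ofReal (f K (X ω) / (1 - α)) := fun K =>
      (((f K).continuous.measurable.comp hX.1).div_const _).ennreal_ofReal
    have hb : ∀ K, ∫⁻ ω, ENNReal.ofReal (f K (X ω) / (1 - α)) ∂μ ≤ 1 := by
      intro K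
      rw [← ofReal_integral_eq_lintegral_ofReal, integral_div, ENNReal.ofReal_le_one,
        div_le_one h1α]
      · exact hint K
      · apply Integrable.div_const
        apply Integrable.of_bound ((f K).continuous.measurable.comp hX.1).aestronglyMeasurable ‖f K‖
        exact Eventually.of_forall fun ω => (f K).norm_coe_le_norm _
      · exact Eventually.of_forall fun ω => div_nonneg (hf0 _ _) h1α.le
    unfold HGle
    calc _ = ∫⁻ ω, liminf (fun K => ENNReal.ofReal (f K (X ω) / (1 - α))) atTop ∂μ := by
          apply lintegral_congr
          intro ω
          symm
          apply Tendsto.liminf_eq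
          apply tendsto_const_nhds.congr'
          obtain ⟨N, hN⟩ := exists_nat_ge (Φ (max ((X ω - (m + ε)) / (c - m + ε)) 0))
          filter_upwards [eventually_ge_atTop N] with K hK
          have : (N:ℝ) ≤ K := by exact_mod_cast hK
          rw [hfe, min_eq_right (by linarith)]
      _ ≤ liminf (fun K => ∫⁻ ω, ENNReal.ofReal (f K (X ω) / (1 - α)) ∂μ) atTop :=
          lintegral_liminf_le hmeas
      _ ≤ liminf (fun _ : ℕ => (1 : ENNReal)) atTop := liminf_le_liminf (Eventually.of_forall hb)
      _ = 1 := by simp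
  have h1 := hg_lux_le hl hle
  have h2 : piHG μ Φ α X ≤ _ := ciInf_le (hg_bdd (μ := μ) hΦ1 hΦ0 hΦmono hΦconv hα hX) (m + ε)
  linarith

end HGHelpers

/-- `π_α` is lower semicontinuous with respect to convergence in distribution if and only if
it satisfies the super Fatou property (lower semicontinuity along a.s.-convergent
sequences, without any domination condition). -/
theorem stmt_14 {Ω : Type*} [MeasurableSpace Ω] (μ : Measure Ω) [IsProbabilityMeasure μ]
    (hNA : ∀ A : Set Ω, MeasurableSet A → 0 < μ A →
      ∃ B : Set Ω, B ⊆ A ∧ MeasurableSet B ∧ 0 < μ B ∧ μ B < μ A)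
    (Φ : ℝ → ℝ) (hΦ0 : Φ 0 = 0) (hΦ1 : Φ 1 = 1)
    (hΦmono : MonotoneOn Φ (Ici 0)) (hΦconv : ConvexOn ℝ (Ici 0) Φ)
    (α : ℝ) (hα : α ∈ Ioo (0 : ℝ) 1) :
    -- (a) lower semicontinuity w.r.t. convergence in distribution
    (∀ (Xn : ℕ → Ω → ℝ) (X : Ω → ℝ), (∀ n, MemOrlicz μ Φ (Xn n)) → MemOrlicz μ Φ X →
      (∀ f : BoundedContinuousFunction ℝ ℝ,
        Tendsto (fun n => ∫ ω, f (Xn n ω) ∂μ) atTop (𝓝 (∫ ω, f (X ω) ∂μ))) →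
      ((piHG μ Φ α X : ℝ) : EReal)
        ≤ Filter.liminf (fun n => ((piHG μ Φ α (Xn n) : ℝ) : EReal)) atTop) ↔
    -- (b) super Fatou property
    (∀ (Xn : ℕ → Ω → ℝ) (X : Ω → ℝ), (∀ n, MemOrlicz μ Φ (Xn n)) → MemOrlicz μ Φ X →
      (∀ᵐ ω ∂μ, Tendsto (fun n => Xn n ω) atTop (𝓝 (X ω))) →
      ((piHG μ Φ α X : ℝ) : EReal)
        ≤ Filter.liminf (fun n => ((piHG μ Φ α (Xn n) : ℝ) : EReal)) atTop) := by
  constructor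
  · intro ha Xn X hXn hX hae
    refine ha Xn X hXn hX fun f => ?_
    apply tendsto_integral_of_dominated_convergence (fun _ => ‖f‖)
    · intro n
      exact (f.continuous.measurable.comp (hXn n).1).aestronglyMeasurable
    · exact integrable_const _
    · intro n
      exact Eventually.of_forall fun ω => f.norm_coe_le_norm _
    · filter_upwards [hae] with ω hω
      exact (f.continuous.tendsto _).comp hω
  · intro _ Xn X hXn hX hd
    exact hg_lsc hΦ1 hΦ0 hΦmono hΦconv hα hXn hX hd
end

section
/- Let Ψ be the conjugate of Φ and let ‖Y‖_{Ψ_α} := sup{ |E[XY]| : X ∈ L^{Φ_α}, ‖X‖_{Φ_α} ≤ 1 } denote the Orlicz norm associated with Ψ_α (the conjugate of Φ_α). Then for every Y ∈ L^Ψ the conjugate function π_α*(Y) := sup_{X ∈ L^Φ} { E[XY] − π_α(X) } satisfies: π_α*(Y) = 0 if Y ≥ 0 a.s., ‖Y‖_{Ψ_α} ≤ 1 and E[Y] = 1; and π_α*(Y) = +∞ otherwise. -/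
open MeasureTheory Filter Set Topology

/-- The conjugate (Legendre transform) `Ψ(y) = sup_{x ≥ 0} (x·y - Φ(x))` of an Orlicz
function `Φ`, with values in `[0, ∞]`. -/
noncomputable def orliczConj (Φ : ℝ → ℝ) (y : ℝ) : ENNReal :=
  ⨆ x : {x : ℝ // 0 ≤ x}, ENNReal.ofReal (x.1 * y - Φ x.1)

/-- Membership in the Orlicz space associated with an extended-real-valued Orlicz
function. -/
def MemOrliczE {Ω : Type*} [MeasurableSpace Ω] (μ : Measure Ω)
    (Θ : ℝ → ENNReal) (X : Ω → ℝ) : Prop :=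
  Measurable X ∧ ∃ l : ℝ, 0 < l ∧ ∫⁻ ω, Θ (|X ω| / l) ∂μ < ⊤

/-- The conjugate function `π_α*(Y) = sup_{X ∈ L^Φ} (E[XY] - π_α(X))`, with values in
`(-∞, ∞]` (formalized in `EReal`). -/
noncomputable def piStarHG {Ω : Type*} [MeasurableSpace Ω] (μ : Measure Ω)
    (Φ : ℝ → ℝ) (α : ℝ) (Y : Ω → ℝ) : EReal :=
  ⨆ X : {X : Ω → ℝ // MemOrlicz μ Φ X},
    (((∫ ω, X.1 ω * Y ω ∂μ) - piHG μ Φ α X.1 : ℝ) : EReal)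


section Helpers

variable {Ω : Type*} [MeasurableSpace Ω] {μ : Measure Ω} {Φ : ℝ → ℝ} {α : ℝ}

theorem hgPhi_nonneg (h0 : Φ 0 = 0) (hm : MonotoneOn Φ (Ici 0)) {x : ℝ} (hx : 0 ≤ x) :
    0 ≤ Φ x := by
  have := hm (mem_Ici.2 le_rfl) (mem_Ici.2 hx) hx
  linarith

theorem hgPhi_scale (h0 : Φ 0 = 0) (hc : ConvexOn ℝ (Ici 0) Φ) {s x : ℝ} (hs : 0 ≤ s)
    (hs1 : s ≤ 1) (hx : 0 ≤ x) : Φ (s * x) ≤ s * Φ x := by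
  have h := hc.2 (mem_Ici.2 hx) (mem_Ici.2 (le_refl (0 : ℝ))) hs (sub_nonneg.2 hs1) (by ring)
  simpa [h0] using h

theorem hgPhi_meas (hm : MonotoneOn Φ (Ici 0)) {X : Ω → ℝ} (hX : Measurable X) {l : ℝ}
    (hl : 0 < l) : Measurable fun ω => Φ (|X ω| / l) := by
  have h1 : Monotone fun x => Φ (max x 0) := by
    intro a b hab
    exact hm (mem_Ici.2 (le_max_right _ _)) (mem_Ici.2 (le_max_right _ _))
      (max_le_max hab le_rfl)
  have h2 : (fun ω => Φ (|X ω| / l)) = fun ω => (fun x => Φ (max x 0)) (|X ω| / l) := by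
    funext ω
    have : 0 ≤ |X ω| / l := by positivity
    simp [max_eq_left this]
  rw [h2]
  have h3 : Measurable fun ω => |X ω| / l := by
    have := hX.abs
    exact this.div_const l
  exact h1.measurable.comp h3

/-- The set in the Luxemburg norm is nonempty on the Orlicz space. -/
theorem hg_nonempty_s15 (h0 : Φ 0 = 0) (hm : MonotoneOn Φ (Ici 0)) (hc : ConvexOn ℝ (Ici 0) Φ)
    (hα : α ∈ Ioo (0 : ℝ) 1) {X : Ω → ℝ} (hX : MemOrlicz μ Φ X) :
    {l : ℝ | 0 < l ∧ ∫⁻ ω, ENNReal.ofReal (Φ (|X ω| / l) / (1 - α)) ∂μ ≤ 1}.Nonempty := by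
  obtain ⟨_, l, hl, hfin⟩ := hX
  set C := (∫⁻ ω, ENNReal.ofReal (Φ (|X ω| / l)) ∂μ) with hC
  have ha : 0 < 1 - α := by linarith [hα.2]
  set t : ℝ := max 1 (C.toReal / (1 - α)) with ht
  have ht1 : 1 ≤ t := le_max_left _ _
  have ht0 : 0 < t := by linarith
  refine ⟨l * t, by positivity, ?_⟩
  have hle : ∀ ω, ENNReal.ofReal (Φ (|X ω| / (l * t)) / (1 - α)) ≤
      ENNReal.ofReal ((1 - α)⁻¹ * t⁻¹) * ENNReal.ofReal (Φ (|X ω| / l)) := by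
    intro ω
    rw [← ENNReal.ofReal_mul (by positivity)]
    apply ENNReal.ofReal_le_ofReal
    have hs := hgPhi_scale (Φ := Φ) h0 hc (s := t⁻¹) (x := |X ω| / l) (by positivity)
      (inv_le_one_of_one_le₀ ht1) (by positivity)
    have he : |X ω| / (l * t) = t⁻¹ * (|X ω| / l) := by field_simp
    rw [he, div_eq_inv_mul, mul_assoc]
    exact mul_le_mul_of_nonneg_left hs (by positivity)
  refine (lintegral_mono hle).trans ?_
  rw [lintegral_const_mul' _ _ ENNReal.ofReal_ne_top, ← hC, ← ENNReal.ofReal_toReal hfin.ne,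
    ← ENNReal.ofReal_mul (by positivity)]
  rw [← ENNReal.ofReal_one]
  apply ENNReal.ofReal_le_ofReal
  have h2 : C.toReal / (1 - α) ≤ t := le_max_right _ _
  calc (1 - α)⁻¹ * t⁻¹ * C.toReal = (C.toReal / (1 - α)) * t⁻¹ := by ring
    _ ≤ t * t⁻¹ := mul_le_mul_of_nonneg_right h2 (by positivity)
    _ = 1 := mul_inv_cancel₀ ht0.ne'

theorem hg_luxNorm_le {Θ : ℝ → ℝ} {X : Ω → ℝ} {l : ℝ} (hl : 0 < l)
    (h : ∫⁻ ω, ENNReal.ofReal (Θ (|X ω| / l)) ∂μ ≤ 1) : luxNorm μ Θ X ≤ l :=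
  csInf_le ⟨0, fun _ hx => hx.1.le⟩ ⟨hl, h⟩

theorem hg_luxNorm_nonneg {Θ : ℝ → ℝ} {X : Ω → ℝ} : 0 ≤ luxNorm μ Θ X :=
  Real.sInf_nonneg fun _ hx => hx.1.le

theorem hg_luxNorm_zero {Θ : ℝ → ℝ} (h0 : Θ 0 = 0) : luxNorm μ Θ (fun _ => 0) = 0 := by
  refine le_antisymm ?_ hg_luxNorm_nonneg
  refine le_of_forall_pos_le_add fun ε hε => ?_
  rw [zero_add]
  exact hg_luxNorm_le hε (by simp [h0])

/-- Domination in the Orlicz space by a multiple plus a constant. -/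
theorem hg_mem_of_le [IsProbabilityMeasure μ] (h0 : Φ 0 = 0) (hm : MonotoneOn Φ (Ici 0))
    (hc : ConvexOn ℝ (Ici 0) Φ) {X Z : Ω → ℝ} (hX : MemOrlicz μ Φ X) (hZ : Measurable Z)
    (m t : ℝ) (ht : 0 < t) (hle : ∀ ω, |Z ω| ≤ t * |X ω| + |m|) : MemOrlicz μ Φ Z := by
  obtain ⟨hXm, l, hl, hfin⟩ := hX
  refine ⟨hZ, 2 * t * l, by positivity, ?_⟩
  have hb : ∀ ω, ENNReal.ofReal (Φ (|Z ω| / (2 * t * l))) ≤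
      ENNReal.ofReal (Φ (|X ω| / l)) + ENNReal.ofReal (Φ (|m| / (t * l))) := by
    intro ω
    have p1 : 0 ≤ |X ω| / l := by positivity
    have p2 : 0 ≤ |m| / (t * l) := by positivity
    have q1 := hgPhi_nonneg h0 hm p1
    have q2 := hgPhi_nonneg h0 hm p2
    rw [← ENNReal.ofReal_add q1 q2]
    apply ENNReal.ofReal_le_ofReal
    have h := hc.2 (mem_Ici.2 p1) (mem_Ici.2 p2)
      (by norm_num : (0 : ℝ) ≤ 1 / 2) (by norm_num : (0 : ℝ) ≤ 1 / 2) (by norm_num)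
    simp only [smul_eq_mul] at h
    have h1 : |Z ω| / (2 * t * l) ≤ 1 / 2 * (|X ω| / l) + 1 / 2 * (|m| / (t * l)) := by
      have : 1 / 2 * (|X ω| / l) + 1 / 2 * (|m| / (t * l)) =
        (t * |X ω| + |m|) / (2 * t * l) := by field_simp
      rw [this]
      exact div_le_div_of_nonneg_right (hle ω) (by positivity)
    have h2 := hm (mem_Ici.2 (by positivity : 0 ≤ |Z ω| / (2 * t * l)))
      (mem_Ici.2 (by positivity)) h1
    linarith
  refine (lintegral_mono hb).trans_lt ?_
  rw [lintegral_add_right _ measurable_const]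
  simpa using hfin

theorem hg_mem_zero (h0 : Φ 0 = 0) : MemOrlicz μ Φ (fun _ => 0) :=
  ⟨measurable_const, 1, one_pos, by simp [h0]⟩

theorem hg_integrable (h0 : Φ 0 = 0) (hm : MonotoneOn Φ (Ici 0)) {X Y : Ω → ℝ}
    (hX : MemOrlicz μ Φ X) (hY : MemOrliczE μ (orliczConj Φ) Y) :
    Integrable (fun ω => X ω * Y ω) μ := by
  obtain ⟨hXm, l, hl, hfin⟩ := hX
  obtain ⟨hYm, k, hk, hfin'⟩ := hY
  refine ⟨(hXm.mul hYm).aestronglyMeasurable, ?_⟩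
  have hb : ∀ ω, ‖X ω * Y ω‖ₑ ≤ ENNReal.ofReal (l * k) *
      (ENNReal.ofReal (Φ (|X ω| / l)) + orliczConj Φ (|Y ω| / k)) := by
    intro ω
    have p1 : 0 ≤ |X ω| / l := by positivity
    have hy : ENNReal.ofReal ((|X ω| / l) * (|Y ω| / k) - Φ (|X ω| / l)) ≤
        orliczConj Φ (|Y ω| / k) :=
      le_iSup (fun x : {x : ℝ // 0 ≤ x} =>
        ENNReal.ofReal (x.1 * (|Y ω| / k) - Φ x.1)) ⟨|X ω| / l, p1⟩
    have h1 : ENNReal.ofReal ((|X ω| / l) * (|Y ω| / k)) ≤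
        ENNReal.ofReal (Φ (|X ω| / l)) + orliczConj Φ (|Y ω| / k) := by
      refine le_trans ?_ (add_le_add le_rfl hy)
      refine le_trans (ENNReal.ofReal_le_ofReal ?_) ENNReal.ofReal_add_le
      linarith
    have h2 : ‖X ω * Y ω‖ₑ = ENNReal.ofReal (l * k) *
        ENNReal.ofReal ((|X ω| / l) * (|Y ω| / k)) := by
      rw [← ENNReal.ofReal_mul (by positivity), ← ofReal_norm, Real.norm_eq_abs, abs_mul]
      congr 1
      field_simp
    rw [h2]
    gcongr
  refine (lintegral_mono hb).trans_lt ?_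
  rw [lintegral_const_mul' _ _ ENNReal.ofReal_ne_top,
    lintegral_add_left (hgPhi_meas hm hXm hl).ennreal_ofReal]
  exact ENNReal.mul_lt_top ENNReal.ofReal_lt_top (ENNReal.add_lt_top.2 ⟨hfin, hfin'⟩)

theorem hg_mem_posPart [IsProbabilityMeasure μ] (h0 : Φ 0 = 0) (hm : MonotoneOn Φ (Ici 0))
    (hc : ConvexOn ℝ (Ici 0) Φ) {X : Ω → ℝ} (hX : MemOrlicz μ Φ X) (m : ℝ) :
    MemOrlicz μ Φ (fun ω => max (X ω - m) 0) := by
  refine hg_mem_of_le h0 hm hc hX ((hX.1.sub_const m).max measurable_const) m 1 one_pos ?_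
  intro ω
  rw [abs_of_nonneg (le_max_right _ _), one_mul]
  refine max_le ?_ (by positivity)
  linarith [le_abs_self (X ω), neg_abs_le m]

/-- Upper bound for the premium of a position bounded below. -/
theorem hg_pi_le [IsProbabilityMeasure μ] (h0 : Φ 0 = 0) (h1 : Φ 1 = 1)
    (hm : MonotoneOn Φ (Ici 0)) (hc : ConvexOn ℝ (Ici 0) Φ)
    (hα : α ∈ Ioo (0 : ℝ) 1) {X : Ω → ℝ} (hX : MemOrlicz μ Φ X) (K : ℝ)
    (hK : ∀ ω, -K ≤ X ω) (m : ℝ) :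
    piHG μ Φ α X ≤ m + luxNorm μ (fun x => Φ x / (1 - α)) (fun ω => max (X ω - m) 0) := by
  refine ciInf_le ⟨-K, ?_⟩ m
  rintro _ ⟨m, rfl⟩
  have ha : 0 < 1 - α := by linarith [hα.2]
  by_cases hmK : -K ≤ m
  · have := hg_luxNorm_nonneg (μ := μ) (Θ := fun x => Φ x / (1 - α))
      (X := fun ω => max (X ω - m) 0)
    simp only
    linarith
  · push Not at hmK
    have : -K - m ≤ luxNorm μ (fun x => Φ x / (1 - α)) (fun ω => max (X ω - m) 0) := by
      refine le_csInf (hg_nonempty_s15 h0 hm hc hα (hg_mem_posPart h0 hm hc hX m)) ?_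
      rintro l ⟨hl, hint⟩
      by_contra! hlt
      have hb : ∀ ω, ENNReal.ofReal (1 / (1 - α)) ≤
          ENNReal.ofReal (Φ (|max (X ω - m) 0| / l) / (1 - α)) := by
        intro ω
        apply ENNReal.ofReal_le_ofReal
        apply div_le_div_of_nonneg_right _ ha.le
        have h2 : 1 ≤ |max (X ω - m) 0| / l := by
          rw [le_div_iff₀ hl, abs_of_nonneg (le_max_right _ _)]
          exact le_trans (by linarith [hK ω]) (le_max_left _ _)
        have h3 := hm (mem_Ici.2 zero_le_one) (mem_Ici.2 (by linarith)) h2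
        linarith
      have h4 := (lintegral_mono (μ := μ) hb).trans hint
      simp only [lintegral_const, measure_univ, mul_one] at h4
      rw [← ENNReal.ofReal_one, ENNReal.ofReal_le_ofReal_iff zero_le_one,
        div_le_iff₀ ha] at h4
      linarith [hα.1]
    simp only
    linarith

theorem hg_top_of (Y : Ω → ℝ) (d : ℝ) (hd : 0 < d)
    (h : ∀ t : ℝ, 0 < t → ∃ X, MemOrlicz μ Φ X ∧
      t * d ≤ (∫ ω, X ω * Y ω ∂μ) - piHG μ Φ α X) : piStarHG μ Φ α Y = ⊤ := by
  rw [EReal.eq_top_iff_forall_lt]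
  intro r
  obtain ⟨X, hX, hle⟩ := h ((|r| + 1) / d) (by positivity)
  rw [div_mul_cancel₀ _ hd.ne'] at hle
  refine lt_of_lt_of_le ?_ (le_iSup (fun X : {X : Ω → ℝ // MemOrlicz μ Φ X} =>
    (((∫ ω, X.1 ω * Y ω ∂μ) - piHG μ Φ α X.1 : ℝ) : EReal)) ⟨X, hX⟩)
  rw [EReal.coe_lt_coe_iff]
  linarith [le_abs_self r]

end Helpers

/-- For `Y ∈ L^Ψ` (with `Ψ` the conjugate of `Φ`): `π_α*(Y) = 0` if `Y ≥ 0` a.s.,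
`‖Y‖_{Ψ_α} ≤ 1` (expressed by duality against the unit ball of the `Φ_α`-Luxemburg norm)
and `E[Y] = 1`; and `π_α*(Y) = +∞` otherwise. -/
theorem stmt_15 {Ω : Type*} [MeasurableSpace Ω] (μ : Measure Ω) [IsProbabilityMeasure μ]
    (hNA : ∀ A : Set Ω, MeasurableSet A → 0 < μ A →
      ∃ B : Set Ω, B ⊆ A ∧ MeasurableSet B ∧ 0 < μ B ∧ μ B < μ A)
    (Φ : ℝ → ℝ) (hΦ0 : Φ 0 = 0) (hΦ1 : Φ 1 = 1)
    (hΦmono : MonotoneOn Φ (Ici 0)) (hΦconv : ConvexOn ℝ (Ici 0) Φ)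
    (α : ℝ) (hα : α ∈ Ioo (0 : ℝ) 1)
    (Y : Ω → ℝ) (hY : MemOrliczE μ (orliczConj Φ) Y) :
    (((0 : Ω → ℝ) ≤ᵐ[μ] Y ∧
        (∀ X : Ω → ℝ, MemOrlicz μ (fun x => Φ x / (1 - α)) X →
          luxNorm μ (fun x => Φ x / (1 - α)) X ≤ 1 → |∫ ω, X ω * Y ω ∂μ| ≤ 1) ∧
        (∫ ω, Y ω ∂μ) = 1) →
      piStarHG μ Φ α Y = 0) ∧
    ((¬ ((0 : Ω → ℝ) ≤ᵐ[μ] Y ∧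
        (∀ X : Ω → ℝ, MemOrlicz μ (fun x => Φ x / (1 - α)) X →
          luxNorm μ (fun x => Φ x / (1 - α)) X ≤ 1 → |∫ ω, X ω * Y ω ∂μ| ≤ 1) ∧
        (∫ ω, Y ω ∂μ) = 1)) →
      piStarHG μ Φ α Y = ⊤) := by
  obtain ⟨hα0, hα1⟩ := id hα
  have ha : 0 < 1 - α := by linarith
  have hmz : MemOrlicz μ Φ (fun _ => 0) := hg_mem_zero hΦ0
  have hmc : ∀ c : ℝ, MemOrlicz μ Φ (fun _ => c) := fun c =>
    hg_mem_of_le hΦ0 hΦmono hΦconv hmz measurable_const c 1 one_pos (by simp)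
  have hYi : Integrable Y μ := by
    simpa using hg_integrable hΦ0 hΦmono (hmc 1) hY
  have hz : luxNorm μ (fun x => Φ x / (1 - α)) (fun _ => 0) = 0 :=
    hg_luxNorm_zero (by simp [hΦ0])
  constructor
  · rintro ⟨hpos, hnorm, hone⟩
    apply le_antisymm
    · refine iSup_le ?_
      rintro ⟨X, hX⟩
      rw [← EReal.coe_zero, EReal.coe_le_coe_iff, sub_nonpos]
      refine le_ciInf fun m => ?_
      have hZ := hg_mem_posPart hΦ0 hΦmono hΦconv hX m
      have hXY := hg_integrable hΦ0 hΦmono hX hY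
      have hZY := hg_integrable hΦ0 hΦmono hZ hY
      have e1 : (∫ ω, X ω * Y ω ∂μ) ≤ ∫ ω, (m * Y ω + max (X ω - m) 0 * Y ω) ∂μ := by
        refine integral_mono_ae hXY ((hYi.const_mul m).add hZY) ?_
        filter_upwards [hpos] with ω hω
        have hω' : 0 ≤ Y ω := hω
        have := mul_le_mul_of_nonneg_right (le_max_left (X ω - m) 0) hω'
        linarith
      rw [integral_add (hYi.const_mul m) hZY, integral_const_mul, hone, mul_one] at e1
      refine e1.trans (add_le_add le_rfl ?_)
      refine le_csInf (hg_nonempty_s15 hΦ0 hΦmono hΦconv hα hZ) ?_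
      rintro l ⟨hl, hint⟩
      have hint' : ∫⁻ ω, ENNReal.ofReal
          (Φ (|max (X ω - m) 0 / l| / 1) / (1 - α)) ∂μ ≤ 1 := by
        simpa only [abs_div, abs_of_pos hl, div_one] using hint
      have hb := hnorm (fun ω => max (X ω - m) 0 / l)
        ⟨hZ.1.div_const l, 1, one_pos, hint'.trans_lt ENNReal.one_lt_top⟩
        (hg_luxNorm_le one_pos hint')
      have e2 : (∫ ω, max (X ω - m) 0 / l * Y ω ∂μ) = (∫ ω, max (X ω - m) 0 * Y ω ∂μ) / l := by
        rw [← integral_div]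
        congr 1
        funext ω
        ring
      rw [e2] at hb
      have := (le_abs_self _).trans hb
      rwa [div_le_one hl] at this
    · have hp : piHG μ Φ α (fun _ => 0) ≤ 0 := by
        have := hg_pi_le hΦ0 hΦ1 hΦmono hΦconv hα hmz 0 (by simp) 0
        simpa [hz] using this
      refine le_trans ?_ (le_iSup (fun X : {X : Ω → ℝ // MemOrlicz μ Φ X} =>
        (((∫ ω, X.1 ω * Y ω ∂μ) - piHG μ Φ α X.1 : ℝ) : EReal)) ⟨_, hmz⟩)
      rw [← EReal.coe_zero, EReal.coe_le_coe_iff]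
      simpa using hp
  · intro hnot
    by_cases hpos : (0 : Ω → ℝ) ≤ᵐ[μ] Y
    swap
    · set A : Set Ω := {ω | Y ω < 0} with hA
      have hAm : MeasurableSet A := measurableSet_lt hY.1 measurable_const
      have hd : 0 < ∫ ω, A.indicator (fun ω => -Y ω) ω ∂μ := by
        have hnn : ∀ ω, 0 ≤ A.indicator (fun ω => -Y ω) ω := by
          intro ω
          apply indicator_nonneg
          intro x hx
          have : Y x < 0 := hx
          linarith
        rw [integral_pos_iff_support_of_nonneg hnn (hYi.neg.indicator hAm)]
        rw [pos_iff_ne_zero]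
        intro h
        apply hpos
        have hsub : {ω | ¬ ((0 : Ω → ℝ) ω ≤ Y ω)} ⊆
            Function.support (A.indicator (fun ω => -Y ω)) := by
          intro ω hω
          have hω' : Y ω < 0 := by simpa using hω
          have : ω ∈ A := hω'
          simp only [Function.mem_support, indicator_of_mem this]
          linarith
        exact measure_mono_null hsub h
      refine hg_top_of Y _ hd fun t ht => ?_
      have hX : MemOrlicz μ Φ (A.indicator (fun _ => -t)) := by
        refine hg_mem_of_le hΦ0 hΦmono hΦconv hmz (measurable_const.indicator hAm) t 1 one_pos ?_
        intro ω
        by_cases h : ω ∈ A <;> simp [h]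
      refine ⟨_, hX, ?_⟩
      have hp := hg_pi_le hΦ0 hΦ1 hΦmono hΦconv hα hX t (by
        intro ω
        by_cases h : ω ∈ A <;> simp [h, ht.le]) 0
      have e1 : (fun ω => max (A.indicator (fun _ => -t) ω - 0) 0) = fun _ => (0 : ℝ) := by
        funext ω
        by_cases h : ω ∈ A <;> simp [h, ht.le]
      rw [e1, hz, add_zero] at hp
      have e2 : (∫ ω, A.indicator (fun _ => -t) ω * Y ω ∂μ) =
          t * ∫ ω, A.indicator (fun ω => -Y ω) ω ∂μ := by
        rw [← integral_const_mul]
        congr 1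
        funext ω
        by_cases h : ω ∈ A <;> simp [h]
      rw [e2]
      linarith
    by_cases hone : (∫ ω, Y ω ∂μ) = 1
    swap
    · have hc : ∀ c : ℝ, c * ((∫ ω, Y ω ∂μ) - 1) ≤
          (∫ ω, (fun _ : Ω => c) ω * Y ω ∂μ) - piHG μ Φ α (fun _ => c) := by
        intro c
        have hp := hg_pi_le hΦ0 hΦ1 hΦmono hΦconv hα (hmc c) |c|
          (fun _ => neg_abs_le c) c
        simp only [sub_self, max_self, hz, add_zero] at hp
        rw [integral_const_mul]
        linarith
      rcases lt_or_gt_of_ne hone with h | h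
      · refine hg_top_of Y (1 - ∫ ω, Y ω ∂μ) (by linarith) fun t ht => ⟨_, hmc (-t), ?_⟩
        refine le_trans (le_of_eq ?_) (hc (-t))
        ring
      · exact hg_top_of Y ((∫ ω, Y ω ∂μ) - 1) (by linarith) fun t ht => ⟨_, hmc t, hc t⟩
    have hn : ∃ X : Ω → ℝ, MemOrlicz μ (fun x => Φ x / (1 - α)) X ∧
          luxNorm μ (fun x => Φ x / (1 - α)) X ≤ 1 ∧ 1 < |∫ ω, X ω * Y ω ∂μ| := by
      by_contra! hcon
      exact hnot ⟨hpos, hcon, hone⟩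
    obtain ⟨X, hXα, hX1, hgt⟩ := hn
    have hX : MemOrlicz μ Φ X := by
      obtain ⟨hXm, l, hl, hfin⟩ := hXα
      refine ⟨hXm, l, hl, ?_⟩
      have e : ∀ ω, ENNReal.ofReal (Φ (|X ω| / l)) =
          ENNReal.ofReal (1 - α) * ENNReal.ofReal (Φ (|X ω| / l) / (1 - α)) := by
        intro ω
        rw [← ENNReal.ofReal_mul ha.le]
        congr 1
        field_simp
      simp_rw [e]
      rw [lintegral_const_mul' _ _ ENNReal.ofReal_ne_top]
      exact ENNReal.mul_lt_top ENNReal.ofReal_lt_top hfin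
    have hgt' : 1 < ∫ ω, |X ω| * Y ω ∂μ := by
      refine hgt.trans_le (abs_integral_le_integral_abs.trans (le_of_eq ?_))
      refine integral_congr_ae ?_
      filter_upwards [hpos] with ω hω
      have hω' : 0 ≤ Y ω := hω
      simp only [abs_mul, abs_of_nonneg hω']
    obtain ⟨l, ⟨hl, hint⟩, hlt⟩ := exists_lt_of_csInf_lt
      (hg_nonempty_s15 hΦ0 hΦmono hΦconv hα hX) (lt_of_le_of_lt hX1 hgt')
    refine hg_top_of Y ((∫ ω, |X ω| * Y ω ∂μ) - l) (by linarith) fun t ht => ?_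
    have hX' : MemOrlicz μ Φ (fun ω => t * |X ω|) := by
      refine hg_mem_of_le hΦ0 hΦmono hΦconv hX (hX.1.abs.const_mul t) 0 t ht ?_
      intro ω
      simp [abs_mul, abs_of_pos ht]
    refine ⟨_, hX', ?_⟩
    have hp := hg_pi_le hΦ0 hΦ1 hΦmono hΦconv hα hX' 0
      (fun ω => by rw [neg_zero]; positivity) 0
    have hN : luxNorm μ (fun x => Φ x / (1 - α)) (fun ω => max (t * |X ω| - 0) 0) ≤ t * l := by
      refine hg_luxNorm_le (by positivity) ?_
      refine le_trans (le_of_eq ?_) hint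
      refine lintegral_congr fun ω => ?_
      have : |max (t * |X ω| - 0) 0| / (t * l) = |X ω| / l := by
        rw [sub_zero, max_eq_left (by positivity), abs_mul, abs_abs, abs_of_pos ht]
        field_simp
      rw [this]
    have e : (∫ ω, t * |X ω| * Y ω ∂μ) = t * ∫ ω, |X ω| * Y ω ∂μ := by
      rw [← integral_const_mul]
      congr 1
      funext ω
      ring
    simp only [e]
    linarith
end
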